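/- arXiv:2509.24409 — 4 statements merged into one kernel-verified Lean document; each statement's English description precedes it below -/
import Mathlib

section
/- Let 𝐤 = (k_1,…,k_t) and 𝐧 = (n_1,…,n_t) with k = k_1+⋯+k_t and n = n_1+⋯+n_t, and let U be an 𝔽_q-subspace of 𝕍(k,q^m) that is 𝐤-scattered with respect to the hyperplanes of type 𝐧. Then a Delsarte dual U^d of U is (𝐧−𝐤)-scattered with respect to the hyperplanes in 𝕍(n−k,q^m) of type 𝐧, where 𝐧−𝐤 = (n_1−k_1,…,n_t−k_t). -/
/-- The weight of the `𝔽_{q^m}`-subspace `T` with respect to the `𝔽_q`-subspace `U`: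
`w_U(T) = dim_{𝔽_q}(U ∩ T)`. -/
noncomputable def wt {K L V : Type*} [Field K] [Field L] [Algebra K L]
    [AddCommGroup V] [Module K V] [Module L V] [IsScalarTower K L V]
    (U : Submodule K V) (T : Submodule L V) : ℕ :=
  Module.finrank K ↥(U ⊓ T.restrictScalars K)

/-- The defect of `T` with respect to `U`: `ε_U(T) = w_U(T) − dim_{𝔽_{q^m}}(T)`. -/
noncomputable def defect {K L V : Type*} [Field K] [Field L] [Algebra K L]
    [AddCommGroup V] [Module K V] [Module L V] [IsScalarTower K L V]
    (U : Submodule K V) (T : Submodule L V) : ℤ :=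
  (wt U T : ℤ) - Module.finrank L ↥T

/-- `ε_U(r)`: the maximum defect of `r`-dimensional `𝔽_{q^m}`-subspaces w.r.t. `U`. -/
noncomputable def maxDefect {K V : Type*} (L : Type*) [Field K] [Field L] [Algebra K L]
    [AddCommGroup V] [Module K V] [Module L V] [IsScalarTower K L V]
    (U : Submodule K V) (r : ℕ) : ℤ :=
  sSup {e : ℤ | ∃ T : Submodule L V, Module.finrank L ↥T = r ∧ e = defect U T}

/-- `U` is `𝐤`-scattered with respect to the hyperplanes, of type `𝐧`:
`U` is decomposable of type `(𝐤,𝐧)` with `k_i < n_i`, each component `U_i` is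
scattered with respect to the hyperplanes of `F_i = ⟨U_i⟩_{𝔽_{q^m}}`, and every
hyperplane of the ambient space containing no component `F_i` meets `U` in
dimension at most `k − 1`. -/
def IsBoldKScattered {K V : Type*} (L : Type*) [Field K] [Field L] [Algebra K L]
    [AddCommGroup V] [Module K V] [Module L V] [IsScalarTower K L V]
    {t : ℕ} (ks ns : Fin t → ℕ) (U : Submodule K V) : Prop :=
  ∃ Us : Fin t → Submodule K V,
    iSupIndep Us ∧ (⨆ i, Us i) = U ∧
    (∀ i, Module.finrank K ↥(Us i) = ns i) ∧
    iSupIndep (fun i => Submodule.span L ((Us i : Set V))) ∧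
    (⨆ i, Submodule.span L ((Us i : Set V))) = ⊤ ∧
    (∀ i, Module.finrank L ↥(Submodule.span L ((Us i : Set V))) = ks i) ∧
    (∀ i, ks i < ns i) ∧
    (∀ i, ∀ H : Submodule L V, H ≤ Submodule.span L ((Us i : Set V)) →
      Module.finrank L ↥H + 1 = ks i →
      Module.finrank K ↥(Us i ⊓ H.restrictScalars K) + 1 ≤ ks i) ∧
    (∀ H : Submodule L V, Module.finrank L ↥H + 1 = Module.finrank L V →
      (∀ i, ¬ Submodule.span L ((Us i : Set V)) ≤ H) →
      Module.finrank K ↥(U ⊓ H.restrictScalars K) + 1 ≤ ∑ i, ks i)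
set_option linter.unusedSectionVars false
open Module

section Basics
variable {K V V' : Type*} [Field K] [AddCommGroup V] [Module K V] [AddCommGroup V'] [Module K V']
  [FiniteDimensional K V]

theorem aux_rank_nullity (f : V →ₗ[K] V') (U : Submodule K V) :
    finrank K (U.map f) + finrank K ↥(U ⊓ LinearMap.ker f) = finrank K U := by
  have h := LinearMap.finrank_range_add_finrank_ker (f.domRestrict U)
  have h1 : LinearMap.range (f.domRestrict U) = U.map f := by
    rw [LinearMap.domRestrict, LinearMap.range_comp, Submodule.range_subtype]
  have h2 : finrank K (LinearMap.ker (f.domRestrict U)) = finrank K ↥(U ⊓ LinearMap.ker f) := by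
    rw [← Submodule.finrank_map_subtype_eq U (LinearMap.ker (f.domRestrict U))]
    have : (LinearMap.ker (f.domRestrict U)).map U.subtype = U ⊓ LinearMap.ker f := by
      ext x; simp [and_comm]
    rw [this]
  rw [h1, h2] at h
  exact h

theorem aux_finrank_map_le (f : V →ₗ[K] V') (U : Submodule K V) :
    finrank K (U.map f) ≤ finrank K U := by
  have := aux_rank_nullity f U
  omega

theorem aux_finrank_map_eq (f : V →ₗ[K] V') (U : Submodule K V)
    (h : ∀ x ∈ U, f x = 0 → x = 0) :
    finrank K (U.map f) = finrank K U := by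
  have h1 := aux_rank_nullity f U
  have : U ⊓ LinearMap.ker f = ⊥ := by
    rw [eq_bot_iff]
    rintro x ⟨hx, hx'⟩
    exact h x hx hx'
  rw [this, finrank_bot] at h1
  omega

theorem aux_biSup_le {ι : Type*} [DecidableEq ι] (f : ι → Submodule K V) (A : Finset ι) :
    finrank K ↥(⨆ i ∈ A, f i) ≤ ∑ i ∈ A, finrank K (f i) := by
  induction A using Finset.induction_on with
  | empty => simp
  | insert a s ha ih =>
    rw [Finset.iSup_insert, Finset.sum_insert ha]
    exact (Submodule.finrank_add_le_finrank_add_finrank _ _).trans (by omega)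

theorem aux_biSup_eq {ι : Type*} [DecidableEq ι] (f : ι → Submodule K V) (hf : iSupIndep f)
    (A : Finset ι) :
    finrank K ↥(⨆ i ∈ A, f i) = ∑ i ∈ A, finrank K (f i) := by
  induction A using Finset.induction_on with
  | empty => simp
  | insert a s ha ih =>
    rw [Finset.iSup_insert, Finset.sum_insert ha]
    have h := Submodule.finrank_sup_add_finrank_inf_eq (f a) (⨆ i ∈ s, f i)
    have hd : f a ⊓ (⨆ i ∈ s, f i) = ⊥ :=
      (hf.disjoint_biSup (x := a) (y := (s : Set ι)) (by simpa using ha)).eq_bot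
    rw [hd, finrank_bot] at h
    omega

theorem aux_iSup_split {ι : Type*} [Fintype ι] [DecidableEq ι] (f : ι → Submodule K V) (i : ι) :
    (⨆ j, f j) = f i ⊔ ⨆ j ∈ Finset.univ.erase i, f j := by
  rw [← Finset.iSup_insert, Finset.insert_erase (Finset.mem_univ i)]
  simp

theorem aux_indep {ι : Type*} [Fintype ι] [DecidableEq ι] (f : ι → Submodule K V)
    (h : ∑ i, finrank K (f i) ≤ finrank K ↥(⨆ i, f i)) : iSupIndep f := by
  intro i
  have e : (⨆ j, ⨆ (_ : j ≠ i), f j) = ⨆ j ∈ Finset.univ.erase i, f j := by simp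
  rw [e, disjoint_iff]
  have h1 := aux_biSup_le f (Finset.univ.erase i)
  have h2 := Submodule.finrank_sup_add_finrank_inf_eq (f i) (⨆ j ∈ Finset.univ.erase i, f j)
  rw [← aux_iSup_split] at h2
  have h3 := Finset.add_sum_erase Finset.univ (fun i => finrank K (f i)) (Finset.mem_univ i)
  exact Submodule.finrank_eq_zero.mp (by omega)

/-- independence and exact dimensions out of upper bounds -/
theorem aux_dims {ι : Type*} [Fintype ι] [DecidableEq ι] (f : ι → Submodule K V) (d : ι → ℕ)
    (hd : ∀ i, finrank K (f i) ≤ d i)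
    (h : ∑ i, d i ≤ finrank K ↥(⨆ i, f i)) : iSupIndep f ∧ ∀ i, finrank K (f i) = d i := by
  have h1 : ∑ i, finrank K (f i) ≤ ∑ i, d i := Finset.sum_le_sum fun i _ => hd i
  have hi := aux_indep f (h1.trans h)
  refine ⟨hi, ?_⟩
  have h2 := aux_biSup_eq f hi Finset.univ
  have e : (⨆ i ∈ (Finset.univ : Finset ι), f i) = ⨆ i, f i := by simp
  rw [e] at h2
  have h3 : ∑ i, finrank K (f i) = ∑ i, d i := by omega
  intro i
  exact (Finset.sum_eq_sum_iff_of_le (fun i _ => hd i)).mp h3 i (Finset.mem_univ i)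

theorem aux_enlarge (W S : Submodule K V) (hS : S ≤ W) (d : ℕ) (h1 : finrank K S ≤ d)
    (h2 : d ≤ finrank K W) : ∃ S' : Submodule K V, S ≤ S' ∧ S' ≤ W ∧ finrank K S' = d := by
  induction d, h1 using Nat.le_induction with
  | base => exact ⟨S, le_rfl, hS, rfl⟩
  | succ d hd ih =>
    obtain ⟨S', a, b, c⟩ := ih (by omega)
    have hlt : S' < W := by
      refine lt_of_le_of_ne b ?_
      rintro rfl
      omega
    obtain ⟨w, hw, hw'⟩ := SetLike.exists_of_lt hlt
    refine ⟨S' ⊔ Submodule.span K {w}, le_sup_of_le_left a, sup_le b (by simpa using hw), ?_⟩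
    have h3 := Submodule.finrank_add_le_finrank_add_finrank S' (Submodule.span K {w})
    have h4 : finrank K (Submodule.span K {w}) ≤ 1 := by
      simpa using finrank_span_le_card (R := K) ({w} : Set V)
    have h5 : S' < S' ⊔ Submodule.span K {w} := by
      refine lt_of_le_of_ne le_sup_left fun h => hw' ?_
      rw [h]
      exact Submodule.mem_sup_right (Submodule.mem_span_singleton_self w)
    have := Submodule.finrank_lt_finrank_of_lt h5
    omega
end Basics

section Tower
variable {K L V : Type*} [Field K] [Field L] [Algebra K L] [FiniteDimensional K L]
    [AddCommGroup V] [Module K V] [Module L V] [IsScalarTower K L V] [FiniteDimensional L V]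
    [FiniteDimensional K V]

theorem aux_span_le (S : Submodule K V) :
    finrank L (Submodule.span L (S : Set V)) ≤ finrank K S := by
  have b := Module.finBasis K S
  have h : Submodule.span L (S : Set V) = Submodule.span L (Set.range fun i => (b i : V)) := by
    apply le_antisymm
    · rw [Submodule.span_le]
      intro x hx
      have := b.sum_repr ⟨x, hx⟩
      have h2 := congrArg Subtype.val this
      simp only [AddSubmonoidClass.coe_finsetSum, Submodule.coe_smul] at h2
      rw [← h2]
      refine Submodule.sum_mem _ fun i _ => ?_
      rw [← algebraMap_smul L]
      exact Submodule.smul_mem _ _ (Submodule.subset_span ⟨i, rfl⟩)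
    · exact Submodule.span_mono (by rintro _ ⟨i, rfl⟩; exact (b i).2)
  rw [h]
  have := finrank_range_le_card (R := L) (fun i => (b i : V))
  rwa [Fintype.card_fin] at this

theorem aux_span_sup (A B : Submodule K V) :
    Submodule.span L ((A ⊔ B : Submodule K V) : Set V)
      = Submodule.span L (A : Set V) ⊔ Submodule.span L (B : Set V) := by
  apply le_antisymm
  · rw [Submodule.span_le]
    intro x hx
    obtain ⟨a, ha, b, hb, rfl⟩ := Submodule.mem_sup.mp hx
    exact Submodule.add_mem_sup (Submodule.subset_span ha) (Submodule.subset_span hb)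
  · exact sup_le (Submodule.span_mono (SetLike.coe_subset_coe.mpr le_sup_left))
      (Submodule.span_mono (SetLike.coe_subset_coe.mpr le_sup_right))

theorem aux_span_iSup {ι : Sort*} (A : ι → Submodule K V) :
    Submodule.span L ((⨆ i, A i : Submodule K V) : Set V)
      = ⨆ i, Submodule.span L (A i : Set V) := by
  apply le_antisymm
  · rw [Submodule.span_le]
    have : (⨆ i, A i) ≤ (⨆ i, Submodule.span L (A i : Set V)).restrictScalars K := by
      refine iSup_le fun i x hx => ?_
      exact Submodule.mem_iSup_of_mem i (Submodule.subset_span hx)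
    exact this
  · exact iSup_le fun i => Submodule.span_mono (SetLike.coe_subset_coe.mpr (le_iSup A i))

/-- subspaces of a subgeometry -/
theorem aux_span_eq (W : Submodule K V)
    (hW : finrank L (Submodule.span L (W : Set V)) = finrank K W) (S : Submodule K V) (hS : S ≤ W) :
    finrank L (Submodule.span L (S : Set V)) = finrank K S := by
  obtain ⟨S', h1, h2⟩ := (ComplementedLattice.exists_isCompl (α := Set.Iic W) ⟨S, hS⟩)
  obtain ⟨S', hS'⟩ := S'
  have hd : S ⊓ S' = ⊥ := by
    have := h1.eq_bot
    exact congrArg Subtype.val this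
  have hs : S ⊔ S' = W := congrArg Subtype.val h2.eq_top
  have a := Submodule.finrank_sup_add_finrank_inf_eq S S'
  rw [hd, hs, finrank_bot] at a
  have b := Submodule.finrank_add_le_finrank_add_finrank (Submodule.span L (S : Set V))
    (Submodule.span L (S' : Set V))
  rw [← aux_span_sup, hs, hW] at b
  have c := aux_span_le (L := L) S
  have d := aux_span_le (L := L) S'
  omega

theorem aux_map_span {V' : Type*} [AddCommGroup V'] [Module K V'] [Module L V']
    [IsScalarTower K L V'] (f : V →ₗ[L] V') (S : Submodule K V) :
    Submodule.span L ((S.map (f.restrictScalars K) : Submodule K V') : Set V')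
      = (Submodule.span L (S : Set V)).map f := by
  rw [Submodule.map_span]; rfl

/-- functional supported on one component with small rank -/
theorem aux_psi {t : ℕ} (ks ns : Fin t → ℕ) (hks : ∀ i, 0 < ks i) (hns : ∀ i, ks i < ns i)
    (hV : finrank L V = ∑ i, ks i)
    (Us : Fin t → Submodule K V) (hUn : ∀ i, finrank K (Us i) = ns i)
    (htop : (⨆ i, Submodule.span L (Us i : Set V)) = ⊤)
    (hUk : ∀ i, finrank L (Submodule.span L (Us i : Set V)) = ks i) (i : Fin t) :
    ∃ ψ : V →ₗ[L] L, (∀ j, j ≠ i → ∀ u ∈ Us j, ψ u = 0) ∧ (∃ u ∈ Us i, ψ u ≠ 0) ∧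
      finrank K ((Us i).map (ψ.restrictScalars K)) + ks i ≤ ns i + 1 := by
  obtain ⟨A, -, hA, hAd⟩ := aux_enlarge (Us i) ⊥ bot_le (ks i - 1) (by simp)
    (by rw [hUn]; have := hns i; omega)
  set T := Submodule.span L (A : Set V) ⊔ ⨆ j ∈ Finset.univ.erase i, Submodule.span L (Us j : Set V)
    with hT
  have hTlt : T < ⊤ := by
    apply Submodule.lt_top_of_finrank_lt_finrank
    have h1 := Submodule.finrank_add_le_finrank_add_finrank (Submodule.span L (A : Set V))
      (⨆ j ∈ Finset.univ.erase i, Submodule.span L (Us j : Set V))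
    have h2 := aux_biSup_le (fun j => Submodule.span L (Us j : Set V)) (Finset.univ.erase i)
    have h3 := aux_span_le (L := L) A
    simp only [hUk] at h2
    have h4 := Finset.add_sum_erase Finset.univ ks (Finset.mem_univ i)
    have := hks i
    rw [hV, hT]
    omega
  obtain ⟨ψ, hψ, hTψ⟩ := Submodule.exists_le_ker_of_lt_top T hTlt
  have h0 : ∀ j, j ≠ i → ∀ u ∈ Us j, ψ u = 0 := by
    intro j hj u hu
    apply hTψ
    refine Submodule.mem_sup_right ?_
    have : Submodule.span L (Us j : Set V) ≤
        ⨆ j ∈ Finset.univ.erase i, Submodule.span L (Us j : Set V) :=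
      le_iSup₂_of_le j (by simp [hj]) le_rfl
    exact this (Submodule.subset_span hu)
  refine ⟨ψ, h0, ?_, ?_⟩
  · by_contra! hc
    apply hψ
    rw [← LinearMap.ker_eq_top, eq_top_iff, ← htop]
    refine iSup_le fun j => Submodule.span_le.mpr fun u hu => ?_
    by_cases hj : j = i
    · subst hj; exact hc u hu
    · exact h0 j hj u hu
  · have h1 := aux_rank_nullity (ψ.restrictScalars K) (Us i)
    have h2 : finrank K A ≤ finrank K ↥(Us i ⊓ LinearMap.ker (ψ.restrictScalars K)) := by
      apply Submodule.finrank_mono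
      refine le_inf hA fun x hx => ?_
      have : x ∈ T := Submodule.mem_sup_left (Submodule.subset_span hx)
      exact hTψ this
    rw [hUn] at h1
    have := hks i
    omega

/-- hereditary property -/
theorem aux_Q {t : ℕ} (ks ns : Fin t → ℕ) (hks : ∀ i, 0 < ks i) (hns : ∀ i, ks i < ns i)
    (hV : finrank L V = ∑ i, ks i)
    (Us : Fin t → Submodule K V) (hUn : ∀ i, finrank K (Us i) = ns i)
    (htop : (⨆ i, Submodule.span L (Us i : Set V)) = ⊤)
    (hUk : ∀ i, finrank L (Submodule.span L (Us i : Set V)) = ks i)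
    (hP : ∀ φ : V →ₗ[L] L, (∀ i, ∃ u ∈ Us i, φ u ≠ 0) →
      ∑ i, ns i + 1 ≤ finrank K ((⨆ i, Us i).map (φ.restrictScalars K)) + ∑ i, ks i)
    (J : Finset (Fin t)) (hJ : J.Nonempty) (φ : V →ₗ[L] L)
    (hφ : ∀ i, i ∈ J ↔ ∃ u ∈ Us i, φ u ≠ 0) :
    ∑ i ∈ J, ns i + 1 ≤ finrank K ((⨆ i, Us i).map (φ.restrictScalars K)) + ∑ i ∈ J, ks i := by
  induction h : Jᶜ.card generalizing J φ with
  | zero =>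
    have : J = Finset.univ := by
      rw [← Finset.compl_eq_empty_iff]; exact Finset.card_eq_zero.mp h
    subst this
    exact hP φ fun i => (hφ i).mp (Finset.mem_univ i)
  | succ d ih =>
    obtain ⟨i, hi⟩ : Jᶜ.Nonempty := Finset.card_pos.mp (by omega)
    have hiJ : i ∉ J := by simpa using hi
    obtain ⟨ψ, hψ0, ⟨u1, hu1, hψ1⟩, hψr⟩ := aux_psi ks ns hks hns hV Us hUn htop hUk i
    obtain ⟨j, hj⟩ := hJ
    obtain ⟨u2, hu2, hφ2⟩ := (hφ j).mp hj
    set c : L := φ u2 / ψ u1 with hc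
    have hc0 : c ≠ 0 := div_ne_zero hφ2 hψ1
    have hφi : ∀ u ∈ Us i, φ u = 0 := by
      intro u hu
      by_contra hne
      exact hiJ ((hφ i).mpr ⟨u, hu, hne⟩)
    have key := ih (insert i J) (Finset.insert_nonempty _ _) (φ + c • ψ) ?_ ?_
    · rw [Finset.sum_insert hiJ, Finset.sum_insert hiJ] at key
      set B := (Us i).map ((c • ψ).restrictScalars K) with hB
      set A := (⨆ i, Us i).map (φ.restrictScalars K) with hA
      have hle : (⨆ i, Us i).map ((φ + c • ψ).restrictScalars K) ≤ A ⊔ B := by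
        rw [Submodule.map_iSup]
        refine iSup_le fun l => ?_
        rintro _ ⟨u, hu, rfl⟩
        by_cases hl : l = i
        · subst hl
          refine Submodule.mem_sup_right ⟨u, hu, ?_⟩
          simp [hφi u hu]
        · refine Submodule.mem_sup_left ⟨u, Submodule.mem_iSup_of_mem l hu, ?_⟩
          simp [hψ0 l hl u hu]
      have h1 := Submodule.finrank_mono hle
      have h2 := Submodule.finrank_sup_add_finrank_inf_eq A B
      have h3 : 0 < finrank K ↥(A ⊓ B) := by
        have : Nontrivial ↥(A ⊓ B) := by
          refine (Submodule.nontrivial_iff_ne_bot).mpr ?_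
          rw [Submodule.ne_bot_iff]
          refine ⟨φ u2, ⟨⟨u2, Submodule.mem_iSup_of_mem j hu2, rfl⟩, ⟨u1, hu1, ?_⟩⟩, hφ2⟩
          simp [hc, div_mul_cancel₀ _ hψ1]
        exact finrank_pos
      have h4 : finrank K B ≤ finrank K ((Us i).map (ψ.restrictScalars K)) := by
        have : B = ((Us i).map (ψ.restrictScalars K)).map
            ((LinearMap.lsmul L L c).restrictScalars K) := by
          rw [← Submodule.map_comp]; rfl
        rw [this]
        exact aux_finrank_map_le _ _
      omega
    · intro l
      rw [Finset.mem_insert]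
      by_cases hl : l = i
      · subst hl
        simp only [true_or, true_iff]
        refine ⟨u1, hu1, ?_⟩
        simp [hφi u1 hu1, hc0, hψ1]
      · simp only [hl, false_or]
        rw [hφ l]
        refine exists_congr fun u => and_congr_right fun hu => ?_
        simp [hψ0 l hl u hu]
    · rw [Finset.compl_insert, Finset.card_erase_of_mem hi]
      omega

/-- the number of components is small -/
theorem aux_card [Fintype K] [Fintype L] {t : ℕ} (ks ns : Fin t → ℕ) (hks : ∀ i, 0 < ks i)
    (hns : ∀ i, ks i < ns i)
    (hV : finrank L V = ∑ i, ks i)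
    (Us : Fin t → Submodule K V) (hUn : ∀ i, finrank K (Us i) = ns i)
    (htop : (⨆ i, Submodule.span L (Us i : Set V)) = ⊤)
    (hUk : ∀ i, finrank L (Submodule.span L (Us i : Set V)) = ks i)
    (hP : ∀ φ : V →ₗ[L] L, (∀ i, ∃ u ∈ Us i, φ u ≠ 0) →
      ∑ i, ns i + 1 ≤ finrank K ((⨆ i, Us i).map (φ.restrictScalars K)) + ∑ i, ks i) :
    t < Fintype.card L := by
  choose ψ h1 h2 h3 using aux_psi ks ns hks hns hV Us hUn htop hUk
  have hp := hP (∑ i, ψ i) (by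
    intro i
    obtain ⟨u, hu, hne⟩ := h2 i
    refine ⟨u, hu, ?_⟩
    rw [LinearMap.sum_apply, Finset.sum_eq_single i]
    · exact hne
    · intro j _ hj
      exact h1 j i (Ne.symm hj) u hu
    · simp)
  have h4 := Submodule.finrank_le ((⨆ i, Us i).map ((∑ i, ψ i).restrictScalars K))
  have h5 : ∑ i, ks i + t ≤ ∑ i, ns i := by
    have : ∑ i : Fin t, (ks i + 1) ≤ ∑ i, ns i := Finset.sum_le_sum fun i _ => hns i
    rw [Finset.sum_add_distrib] at this
    simpa using this
  have h6 : finrank K L < Fintype.card L := by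
    rw [Module.card_eq_pow_finrank (K := K) (V := L)]
    exact Nat.lt_pow_self Fintype.one_lt_card
  omega

/-- functional vanishing on `T` and on no component not inside `T` -/
theorem aux_avoid [Fintype L] {t : ℕ} (ht : t < Fintype.card L)
    (Us : Fin t → Submodule K V) (T : Submodule L V) (J : Finset (Fin t))
    (hJ : ∀ j ∈ J, ∃ u ∈ Us j, u ∉ T) :
    ∃ φ : V →ₗ[L] L, T ≤ LinearMap.ker φ ∧ ∀ j ∈ J, ∃ u ∈ Us j, φ u ≠ 0 := by
  choose! u hu hu' using hJ
  let D : Submodule L (V →ₗ[L] L) := T.dualAnnihilator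
  let p : J → Submodule L D := fun j =>
    LinearMap.ker ((Module.Dual.eval L V (u j)).domRestrict D)
  have hp : ∀ j, p j ≠ ⊤ := by
    intro j h
    obtain ⟨f, hf, hf'⟩ := Submodule.exists_le_ker_of_notMem (hu' j j.2)
    have hfD : f ∈ D := (Submodule.mem_dualAnnihilator f).mpr fun w hw => hf' hw
    have : (⟨f, hfD⟩ : D) ∈ p j := h ▸ Submodule.mem_top
    exact hf this
  have := Submodule.iUnion_ssubset_of_forall_ne_top_of_card_lt (K := L) (M := D)
    (Finset.univ : Finset J) p hp (by
    rw [ENat.card_eq_coe_fintype_card (α := L)]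
    have : J.card ≤ t := by simpa using Finset.card_le_univ J
    simp only [Finset.card_univ, Fintype.card_coe]
    exact_mod_cast lt_of_le_of_lt this ht)
  obtain ⟨⟨f, hfD⟩, -, hf⟩ := Set.exists_of_ssubset this
  refine ⟨f, fun w hw => (Submodule.mem_dualAnnihilator f).mp hfD w hw, fun j hj => ⟨u j, hu j hj, ?_⟩⟩
  intro h0
  apply hf
  simp only [Set.mem_iUnion]
  exact ⟨⟨j, hj⟩, Finset.mem_univ _, h0⟩

end Tower
section Dual
variable {K L Vn V : Type*} [Field K] [Field L] [Algebra K L] [FiniteDimensional K L]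
    [AddCommGroup Vn] [Module K Vn] [Module L Vn] [IsScalarTower K L Vn] [FiniteDimensional L Vn]
    [FiniteDimensional K Vn]
    [AddCommGroup V] [Module K V] [Module L V] [IsScalarTower K L V] [FiniteDimensional L V]
    [FiniteDimensional K V]

/-- the key claim -/
theorem aux_claim [Fintype K] [Fintype L] {t : ℕ} (htL : t < Fintype.card L) (ks ns : Fin t → ℕ)
    (hns : ∀ i, ks i < ns i)
    (hV : finrank L V = ∑ i, ks i) (π : Vn →ₗ[L] V) (Ws : Fin t → Submodule K Vn)
    (hWind : iSupIndep Ws) (hWn : ∀ i, finrank K (Ws i) = ns i)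
    (hWstar : finrank L (Submodule.span L ((⨆ i, Ws i : Submodule K Vn) : Set Vn))
      = finrank K ↥(⨆ i, Ws i))
    (htop : (⨆ i, Submodule.span L ((Ws i).map (π.restrictScalars K) : Set V)) = ⊤)
    (hUk : ∀ i, finrank L (Submodule.span L ((Ws i).map (π.restrictScalars K) : Set V)) = ks i)
    (hQ : ∀ (J : Finset (Fin t)), J.Nonempty → ∀ (φ : V →ₗ[L] L),
      (∀ i, i ∈ J ↔ ∃ u ∈ (Ws i).map (π.restrictScalars K), φ u ≠ 0) →
      ∑ i ∈ J, ns i + 1 ≤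
        finrank K ((⨆ i, (Ws i).map (π.restrictScalars K)).map (φ.restrictScalars K))
          + ∑ i ∈ J, ks i)
    (J : Finset (Fin t)) (hJ : J.Nonempty) (S : Submodule K Vn) (hSW : S ≤ ⨆ i, Ws i)
    (hSJ : ∀ i, i ∉ J → Ws i ≤ S)
    (hSd : finrank K S ≤ ∑ i ∈ Jᶜ, ns i + ∑ i ∈ J, ks i) (v : Vn) (hv : π v = 0)
    (hvS : v ∈ Submodule.span L (S : Set Vn))
    (hvJ : ∀ j ∈ J, v ∉ Submodule.span L ((⨆ i ∈ Finset.univ.erase j, Ws i : Submodule K Vn) : Set Vn)) :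
    False := by
  induction J using Finset.strongInduction generalizing S with
  | H J ih =>
  have hn : finrank K ↥(⨆ i, Ws i) = ∑ i, ns i := by
    have := aux_biSup_eq Ws hWind Finset.univ
    simp only [hWn] at this
    have e : (⨆ i ∈ (Finset.univ : Finset (Fin t)), Ws i) = ⨆ i, Ws i := by simp
    rw [e] at this
    exact this
  have hnJ := Finset.sum_compl_add_sum J ns
  have hkJ := Finset.sum_compl_add_sum J ks
  have hle : ∑ i ∈ J, ks i ≤ ∑ i ∈ J, ns i := Finset.sum_le_sum fun i _ => (hns i).le
  obtain ⟨S', hSS', hS'W, hS'd⟩ := aux_enlarge (⨆ i, Ws i) S hSW _ hSd (by omega)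
  have hvS' : v ∈ Submodule.span L (S' : Set Vn) := Submodule.span_mono hSS' hvS
  set T := (Submodule.span L (S' : Set Vn)).map π with hT
  have hmem : ∀ s ∈ S', π s ∈ T := fun s hs => ⟨s, Submodule.subset_span hs, rfl⟩
  -- T is proper
  have hTtop : T ≠ ⊤ := by
    intro hTt
    set E := Submodule.span L ((⨆ i ∈ Jᶜ, Ws i : Submodule K Vn) : Set Vn) with hE
    have hWJ : (⨆ i ∈ Jᶜ, Ws i : Submodule K Vn) ≤ S' :=
      iSup₂_le fun i hi => (hSJ i (by simpa using hi)).trans hSS'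
    have hES : E ≤ Submodule.span L (S' : Set Vn) := Submodule.span_mono hWJ
    have h1 := aux_rank_nullity π (Submodule.span L (S' : Set Vn))
    have h2 := aux_rank_nullity π E
    have h3 := aux_span_eq (L := L) _ hWstar S' hS'W
    have h4 := aux_span_eq (L := L) _ hWstar (⨆ i ∈ Jᶜ, Ws i) (hWJ.trans hS'W)
    have h5 := aux_biSup_eq Ws hWind Jᶜ
    rw [← hE] at h4
    simp only [hWn] at h5
    have h6 : finrank L (E.map π) ≤ ∑ i ∈ Jᶜ, ks i := by
      have : E.map π = ⨆ i ∈ Jᶜ, Submodule.span L ((Ws i).map (π.restrictScalars K) : Set V) := by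
        simp only [hE, aux_span_iSup, Submodule.map_iSup, aux_map_span]
      rw [this]
      have := aux_biSup_le
        (fun i => Submodule.span L ((Ws i).map (π.restrictScalars K) : Set V)) Jᶜ
      simpa only [hUk] using this
    rw [← hT, hTt, finrank_top, hV] at h1
    have h7 : E ⊓ LinearMap.ker π = Submodule.span L (S' : Set Vn) ⊓ LinearMap.ker π := by
      apply Submodule.eq_of_le_of_finrank_le (inf_le_inf_right _ hES)
      omega
    have h8 : v ∈ E := by
      have : v ∈ Submodule.span L (S' : Set Vn) ⊓ LinearMap.ker π := ⟨hvS', hv⟩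
      rw [← h7] at this
      exact this.1
    obtain ⟨j, hj⟩ := hJ
    refine hvJ j hj (Submodule.span_mono ?_ h8)
    refine SetLike.coe_subset_coe.mpr (iSup₂_le fun i hi => ?_)
    refine le_iSup₂_of_le (f := fun i _ => Ws i) i ?_ le_rfl
    simp only [Finset.mem_erase, Finset.mem_univ, and_true]
    rintro rfl
    simp [hj] at hi
  classical
  set J' : Finset (Fin t) :=
    Finset.univ.filter fun j => ∃ u ∈ (Ws j).map (π.restrictScalars K), u ∉ T with hJ'
  have hJ'J : J' ⊆ J := by
    intro j hj
    by_contra hjJ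
    obtain ⟨-, u, ⟨w, hw, rfl⟩, hu⟩ := Finset.mem_filter.mp hj
    exact hu (hmem w (hSS' (hSJ j hjJ hw)))
  have hJ'ne : J'.Nonempty := by
    rw [Finset.nonempty_iff_ne_empty]
    intro he
    apply hTtop
    rw [eq_top_iff, ← htop]
    refine iSup_le fun j => Submodule.span_le.mpr fun u hu => ?_
    by_contra hne
    have : j ∈ J' := Finset.mem_filter.mpr ⟨Finset.mem_univ _, u, hu, hne⟩
    simp [he] at this
  obtain ⟨φ, hφT, hφJ⟩ := aux_avoid htL (fun i => (Ws i).map (π.restrictScalars K)) T J'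
    (fun j hj => (Finset.mem_filter.mp hj).2)
  have hq := hQ J' hJ'ne φ (by
    intro i
    refine ⟨hφJ i, ?_⟩
    rintro ⟨u, hu, hne⟩
    exact Finset.mem_filter.mpr ⟨Finset.mem_univ _, u, hu, fun h => hne (hφT h)⟩)
  rw [← Submodule.map_iSup, ← Submodule.map_comp] at hq
  set f : Vn →ₗ[K] L := (φ.restrictScalars K) ∘ₗ (π.restrictScalars K) with hf
  have h1 := aux_rank_nullity f (⨆ i, Ws i)
  set S2 := S' ⊔ ⨆ i ∈ J'ᶜ, Ws i with hS2
  have hS2W : S2 ≤ ⨆ i, Ws i := sup_le hS'W (iSup₂_le fun i _ => le_iSup Ws i)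
  have h2 : finrank K S2 ≤ finrank K ↥((⨆ i, Ws i) ⊓ LinearMap.ker f) := by
    apply Submodule.finrank_mono
    refine le_inf hS2W (sup_le ?_ (iSup₂_le fun i hi => ?_))
    · intro s hs
      exact hφT (hmem s hs)
    · intro s hs
      by_contra hne
      have : i ∈ J' := Finset.mem_filter.mpr ⟨Finset.mem_univ _, _, ⟨s, hs, rfl⟩,
        fun h => hne (hφT h)⟩
      simp [this] at hi
  have hnJ' := Finset.sum_compl_add_sum J' ns
  have h3 : finrank K S2 + 1 ≤ ∑ i ∈ J'ᶜ, ns i + ∑ i ∈ J', ks i := by omega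
  by_cases hEq : J' = J
  · have : finrank K S' ≤ finrank K S2 := Submodule.finrank_mono le_sup_left
    rw [hEq] at h3
    omega
  · refine ih J' (lt_of_le_of_ne hJ'J hEq) hJ'ne S2 hS2W ?_ (by omega) ?_ ?_
    · intro i hi
      exact le_sup_of_le_right (le_iSup₂_of_le (f := fun i _ => Ws i) i (by simpa using hi) le_rfl)
    · exact Submodule.span_mono (SetLike.coe_subset_coe.mpr le_sup_left) hvS'
    · exact fun j hj => hvJ j (hJ'J hj)

/-- orthogonal complement inside the subgeometry -/
theorem aux_perp (W : Submodule K Vn) (hW : finrank K W = finrank L Vn)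
    (hWstar : finrank L (Submodule.span L (W : Set Vn)) = finrank L Vn)
    (σ : Vn →ₗ[L] Vn →ₗ[L] L)
    (hσnd : LinearMap.BilinForm.Nondegenerate σ)
    (hσW : ∀ x ∈ W, ∀ y ∈ W, σ x y ∈ (algebraMap K L).range)
    (S : Submodule K Vn) (hS : S ≤ W) :
    finrank K ↥(W ⊓ (LinearMap.BilinForm.orthogonal σ (Submodule.span L (S : Set Vn))).restrictScalars K)
      + finrank K S = finrank L Vn ∧
    Submodule.span L ((W ⊓ (LinearMap.BilinForm.orthogonal σ
      (Submodule.span L (S : Set Vn))).restrictScalars K : Submodule K Vn) : Set Vn)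
      = LinearMap.BilinForm.orthogonal σ (Submodule.span L (S : Set Vn)) := by
  set O := LinearMap.BilinForm.orthogonal σ (Submodule.span L (S : Set Vn)) with hO
  set R : Submodule K Vn := W ⊓ O.restrictScalars K with hR
  have hWs : finrank L (Submodule.span L (W : Set Vn)) = finrank K W := hWstar.trans hW.symm
  have hsub : Submodule.span L (R : Set Vn) ≤ O := Submodule.span_le.mpr fun x hx => hx.2
  have h1 := aux_span_eq (L := L) W hWs S hS
  have h2 := aux_span_eq (L := L) W hWs R inf_le_left
  have h3 : finrank L O = finrank L Vn - finrank L (Submodule.span L (S : Set Vn)) :=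
    LinearMap.BilinForm.finrank_orthogonal hσnd _
  have h4 := Submodule.finrank_le (Submodule.span L (S : Set Vn))
  have h5 := Submodule.finrank_mono hsub
  have h6 : finrank L Vn ≤ finrank K R + finrank K S := by
    obtain ⟨τ, hτ⟩ := LinearMap.exists_leftInverse_of_injective (Algebra.linearMap K L)
      (LinearMap.ker_eq_bot.mpr (algebraMap K L).injective)
    let g : W →ₗ[K] Module.Dual K S :=
      { toFun := fun w => τ ∘ₗ ((σ.flip (w : Vn)).restrictScalars K) ∘ₗ S.subtype
        map_add' := by
          intro x y; ext s; simp
        map_smul' := by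
          intro c x; ext s
          simp only [Submodule.coe_smul, LinearMap.comp_apply, Submodule.subtype_apply,
            LinearMap.coe_restrictScalars, LinearMap.flip_apply, RingHom.id_apply,
            LinearMap.smul_apply]
          rw [← algebraMap_smul L c (x : Vn), map_smul, algebraMap_smul, map_smul] }
    have hg := LinearMap.finrank_range_add_finrank_ker g
    have hr := Submodule.finrank_le (LinearMap.range g)
    rw [Subspace.dual_finrank_eq] at hr
    have hk : finrank K (LinearMap.ker g) ≤ finrank K R := by
      rw [← Submodule.finrank_map_subtype_eq W (LinearMap.ker g)]
      apply Submodule.finrank_mono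
      rintro _ ⟨w, hw, rfl⟩
      refine ⟨w.2, ?_⟩
      rw [Submodule.coe_restrictScalars, SetLike.mem_coe, hO,
        LinearMap.BilinForm.mem_orthogonal_iff]
      have : Submodule.span L (S : Set Vn) ≤ LinearMap.ker (σ.flip (w : Vn)) := by
        refine Submodule.span_le.mpr fun s hs => ?_
        obtain ⟨c, hc⟩ := hσW s (hS hs) w w.2
        have e : τ (σ s w) = 0 := LinearMap.congr_fun (show g w = 0 from hw) ⟨s, hs⟩
        rw [← hc] at e
        have e2 : τ (algebraMap K L c) = c := LinearMap.congr_fun hτ c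
        rw [e2] at e
        change σ s w = 0
        rw [← hc, e, map_zero]
      exact fun n hn => this hn
    omega
  refine ⟨by omega, Submodule.eq_of_le_of_finrank_le hsub (by omega)⟩

/-- support of a vector -/
theorem aux_support (W : Submodule K Vn) (hW : finrank K W = finrank L Vn)
    (hWstar : finrank L (Submodule.span L (W : Set Vn)) = finrank L Vn)
    (σ : Vn →ₗ[L] Vn →ₗ[L] L)
    (hσnd : LinearMap.BilinForm.Nondegenerate σ)
    (hσrefl : LinearMap.IsRefl σ)
    (hσW : ∀ x ∈ W, ∀ y ∈ W, σ x y ∈ (algebraMap K L).range) (v : Vn) :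
    ∃ S ≤ W, v ∈ Submodule.span L (S : Set Vn) ∧
      finrank K S = finrank K (W.map ((σ v).restrictScalars K)) := by
  obtain ⟨h1, h2⟩ := aux_perp W hW hWstar σ hσnd hσW
    (W ⊓ LinearMap.ker ((σ v).restrictScalars K)) inf_le_left
  refine ⟨W ⊓ (LinearMap.BilinForm.orthogonal σ (Submodule.span L
    ((W ⊓ LinearMap.ker ((σ v).restrictScalars K) : Submodule K Vn) : Set Vn))).restrictScalars K,
    inf_le_left, ?_, ?_⟩
  · rw [h2, LinearMap.BilinForm.mem_orthogonal_iff]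
    have : Submodule.span L ((W ⊓ LinearMap.ker ((σ v).restrictScalars K) : Submodule K Vn) : Set Vn)
        ≤ LinearMap.ker (σ v) := Submodule.span_le.mpr fun x hx => hx.2
    exact fun n hn => hσrefl _ _ (this hn)
  · have := aux_rank_nullity ((σ v).restrictScalars K) W
    omega
end Dual
/-- Theorem 1.43: the Delsarte dual of a `𝐤`-scattered subspace w.r.t. the
hyperplanes of type `𝐧` is `(𝐧−𝐤)`-scattered w.r.t. the hyperplanes of type `𝐧`. -/
theorem statement14 {K L Vn : Type*} [Field K] [Field L] [Algebra K L]
    [Fintype K] [Fintype L]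
    [AddCommGroup Vn] [Module K Vn] [Module L Vn] [IsScalarTower K L Vn]
    [FiniteDimensional L Vn]
    (m : ℕ) (hm : 0 < m) (hmL : Module.finrank K L = m)
    (t : ℕ) (ht : 0 < t) (ks ns : Fin t → ℕ)
    (hks : ∀ i, 0 < ks i) (hns : ∀ i, ks i < ns i)
    (k n : ℕ) (hk : k = ∑ i, ks i) (hn : n = ∑ i, ns i) (hkn : k < n)
    (hVn : Module.finrank L Vn = n)
    (W : Submodule K Vn) (hW : Module.finrank K ↥W = n)
    (hWstar : Module.finrank L ↥(Submodule.span L (W : Set Vn)) = n)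
    (σ : Vn →ₗ[L] Vn →ₗ[L] L)
    (hσnd : LinearMap.BilinForm.Nondegenerate σ)
    (hσrefl : LinearMap.IsRefl σ)
    (hσW : ∀ x ∈ W, ∀ y ∈ W, σ x y ∈ (algebraMap K L).range)
    (hσ'nd : ∀ x ∈ W, (∀ y ∈ W, σ x y = 0) → x = 0)
    (Γ : Submodule L Vn) (hΓ : Module.finrank L ↥Γ = n - k)
    (hΓW : Γ.restrictScalars K ⊓ W = ⊥)
    (hVk : Module.finrank L (Vn ⧸ Γ) = k)
    (U : Submodule K (Vn ⧸ Γ)) (hU : U = Submodule.map (Γ.mkQ.restrictScalars K) W)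
    (Ud : Submodule K (Vn ⧸ LinearMap.BilinForm.orthogonal σ Γ))
    (hUd : Ud = Submodule.map ((LinearMap.BilinForm.orthogonal σ Γ).mkQ.restrictScalars K) W)
    -- `U` is `𝐤`-scattered with respect to the hyperplanes, of type `𝐧`
    (hscat : IsBoldKScattered L ks ns U) :
    -- `U^d` is `(𝐧−𝐤)`-scattered with respect to the hyperplanes, of type `𝐧`
    IsBoldKScattered L (fun i => ns i - ks i) ns Ud := by
  classical
  have : FiniteDimensional K L := Module.Finite.of_finite
  have : FiniteDimensional K Vn := Module.Finite.trans L Vn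
  have : FiniteDimensional K (Vn ⧸ Γ) := Module.Finite.trans L (Vn ⧸ Γ)
  have : FiniteDimensional K (Vn ⧸ LinearMap.BilinForm.orthogonal σ Γ) :=
    Module.Finite.trans L (Vn ⧸ LinearMap.BilinForm.orthogonal σ Γ)
  obtain ⟨Us, hUind, hUsup, hUn, hFind, hFtop, hFk, -, -, hPH⟩ := hscat
  have hVk' : finrank L (Vn ⧸ Γ) = ∑ i, ks i := hVk.trans hk
  set π : Vn →ₗ[L] (Vn ⧸ Γ) := Γ.mkQ with hπ
  have hπinj : ∀ x ∈ W, (π.restrictScalars K) x = 0 → x = 0 := by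
    intro x hx h0
    have h1 : x ∈ Γ := (Submodule.Quotient.mk_eq_zero Γ).mp h0
    have h2 : x ∈ Γ.restrictScalars K ⊓ W := ⟨h1, hx⟩
    rw [hΓW] at h2
    exact h2
  have hUdim : finrank K U = n := by
    rw [hU, aux_finrank_map_eq _ _ hπinj, hW]
  -- functional form of the hypothesis
  have hP : ∀ φ : (Vn ⧸ Γ) →ₗ[L] L, (∀ i, ∃ u ∈ Us i, φ u ≠ 0) →
      ∑ i, ns i + 1 ≤ finrank K ((⨆ i, Us i).map (φ.restrictScalars K)) + ∑ i, ks i := by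
    intro φ hφ
    have hφ0 : φ ≠ 0 := by
      rintro rfl
      obtain ⟨u, -, h⟩ := hφ ⟨0, ht⟩
      exact h rfl
    have h1 := hPH (LinearMap.ker φ) (Module.Dual.finrank_ker_add_one_of_ne_zero hφ0) (by
      intro i hi
      obtain ⟨u, hu, h⟩ := hφ i
      exact h (hi (Submodule.subset_span hu)))
    have h2 := aux_rank_nullity (φ.restrictScalars K) U
    have h3 : LinearMap.ker (φ.restrictScalars K) = (LinearMap.ker φ).restrictScalars K := rfl
    rw [h3] at h2
    rw [hUsup, ← hn]
    omega
  have hQ := aux_Q ks ns hks hns hVk' Us hUn hFtop hFk hP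
  have htL := aux_card ks ns hks hns hVk' Us hUn hFtop hFk hP
  -- the decomposition of `W`
  set Ws : Fin t → Submodule K Vn := fun i => W ⊓ (Us i).comap (π.restrictScalars K) with hWsdef
  have hWsW : ∀ i, Ws i ≤ W := fun i => inf_le_left
  have hmapWs : ∀ i, (Ws i).map (π.restrictScalars K) = Us i := by
    intro i
    apply le_antisymm
    · rintro _ ⟨w, hw, rfl⟩
      exact hw.2
    · intro u hu
      have : u ∈ U := hUsup ▸ Submodule.mem_iSup_of_mem i hu
      rw [hU] at this
      obtain ⟨w, hw, rfl⟩ := this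
      exact ⟨w, ⟨hw, hu⟩, rfl⟩
  have hWn : ∀ i, finrank K (Ws i) = ns i := by
    intro i
    rw [← hUn i, ← hmapWs i]
    exact (aux_finrank_map_eq _ _ fun x hx => hπinj x (hWsW i hx)).symm
  have hWsup : (⨆ i, Ws i) = W := by
    apply Submodule.eq_of_le_of_finrank_le (iSup_le hWsW)
    have h1 := aux_finrank_map_le (π.restrictScalars K) (⨆ i, Ws i)
    have h2 : (⨆ i, Ws i).map (π.restrictScalars K) = U := by
      rw [Submodule.map_iSup, ← hUsup]
      exact iSup_congr hmapWs
    rw [h2, hUdim] at h1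
    rw [hW]
    exact h1
  have hWind : iSupIndep Ws :=
    (aux_dims Ws ns (fun i => (hWn i).le) (by rw [hWsup, hW, hn])).1
  have hWs : finrank L (Submodule.span L (W : Set Vn)) = finrank K W := hWstar.trans hW.symm
  have hnV : finrank K W = finrank L Vn := hW.trans hVn.symm
  have hstarV : finrank L (Submodule.span L (W : Set Vn)) = finrank L Vn := hWstar.trans hVn.symm
  -- partial sums
  set N : Fin t → Submodule K Vn := fun i => ⨆ j ∈ Finset.univ.erase i, Ws j with hN
  have hNW : ∀ i, N i ≤ W := fun i => iSup₂_le fun j _ => hWsW j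
  have hNd : ∀ i, finrank K (N i) + ns i = n := by
    intro i
    have h1 := aux_biSup_eq Ws hWind (Finset.univ.erase i)
    simp only [hWn] at h1
    have h2 := Finset.add_sum_erase Finset.univ ns (Finset.mem_univ i)
    have h3 : finrank K (N i) = _ := h1
    omega
  have hWsN : ∀ i j, j ≠ i → Ws j ≤ N i := fun i j hj =>
    le_iSup₂_of_le (f := fun j _ => Ws j) j (by simp [hj]) le_rfl
  set E : Fin t → Submodule L Vn := fun i => Submodule.span L (N i : Set Vn) with hE
  -- the dual bound
  have hD : ∀ v ∈ Γ, ∀ J : Finset (Fin t), J.Nonempty → (∀ j ∈ J, v ∉ E j) →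
      ∑ i ∈ J, ks i + 1 ≤ finrank K (W.map ((σ v).restrictScalars K)) := by
    intro v hv J hJ hvJ
    by_contra hlt
    obtain ⟨S, hSW, hvS, hSd⟩ := aux_support W hnV hstarV σ hσnd hσrefl hσW v
    refine aux_claim (V := Vn ⧸ Γ) htL ks ns hns hVk' π Ws hWind hWn (by rw [hWsup]; exact hWs)
      ?_ ?_ ?_ J hJ (S ⊔ ⨆ i ∈ Jᶜ, Ws i) ?_ ?_ ?_ v ?_ ?_ hvJ
    · simp only [hmapWs]; exact hFtop
    · intro i
      rw [hmapWs i]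
      exact hFk i
    · intro J hJ φ hφ
      have e : (⨆ i, (Ws i).map (π.restrictScalars K)) = ⨆ i, Us i := iSup_congr hmapWs
      rw [e]
      exact hQ J hJ φ (fun i => by rw [hφ i, hmapWs i])
    · rw [hWsup]
      exact sup_le hSW (iSup₂_le fun j _ => hWsW j)
    · intro i hi
      exact le_sup_of_le_right (le_iSup₂_of_le (f := fun i _ => Ws i) i (by simpa using hi) le_rfl)
    · have h1 := Submodule.finrank_add_le_finrank_add_finrank S (⨆ i ∈ Jᶜ, Ws i)
      have h2 := aux_biSup_le Ws Jᶜ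
      simp only [hWn] at h2
      omega
    · exact (Submodule.Quotient.mk_eq_zero Γ).mpr hv
    · exact Submodule.span_mono (SetLike.coe_subset_coe.mpr le_sup_left) hvS
  -- dual decomposition
  set Wd : Fin t → Submodule K Vn := fun i =>
    W ⊓ (LinearMap.BilinForm.orthogonal σ (E i)).restrictScalars K with hWd
  have hWdW : ∀ i, Wd i ≤ W := fun i => inf_le_left
  have hWdn : ∀ i, finrank K (Wd i) = ns i := by
    intro i
    have h1 := (aux_perp W hnV hstarV σ hσnd hσW (N i) (hNW i)).1
    have h2 : finrank K (Wd i) + finrank K (N i) = finrank L Vn := h1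
    have h3 := hNd i
    omega
  have hWdspan : ∀ i, Submodule.span L (Wd i : Set Vn) = LinearMap.BilinForm.orthogonal σ (E i) :=
    fun i => (aux_perp W hnV hstarV σ hσnd hσW (N i) (hNW i)).2
  have hWdind : iSupIndep Wd := by
    intro i
    rw [disjoint_iff, eq_bot_iff]
    rintro x ⟨hx1, hx2⟩
    refine hσ'nd x hx1.1 ?_
    have hle : W ≤ (LinearMap.ker (σ x)).restrictScalars K := by
      conv_lhs => rw [← hWsup]
      refine iSup_le fun j y hy => ?_
      by_cases hj : j = i
      · subst hj
        have h1 : (⨆ l, ⨆ (_ : l ≠ j), Wd l) ≤ (LinearMap.ker (σ y)).restrictScalars K := by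
          refine iSup₂_le fun l hl z hz => ?_
          exact hz.2 y (Submodule.subset_span (hWsN l j hl.symm hy))
        exact hσrefl _ _ (h1 hx2)
      · exact hσrefl _ _ (hx1.2 y (Submodule.subset_span (hWsN i j hj hy)))
    exact fun y hy => hle hy
  have hWdsup : (⨆ i, Wd i) = W := by
    apply Submodule.eq_of_le_of_finrank_le (iSup_le hWdW)
    have h1 := aux_biSup_eq Wd hWdind Finset.univ
    have e : (⨆ i ∈ (Finset.univ : Finset (Fin t)), Wd i) = ⨆ i, Wd i := by simp
    simp only [hWdn] at h1
    rw [e] at h1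
    rw [h1, hW, hn]
  set ρ : Vn →ₗ[L] (Vn ⧸ (LinearMap.BilinForm.orthogonal σ Γ)) := (LinearMap.BilinForm.orthogonal σ Γ).mkQ with hρ
  have hOd : finrank L (LinearMap.BilinForm.orthogonal σ Γ) = k := by
    have : finrank L (LinearMap.BilinForm.orthogonal σ Γ) = _ := LinearMap.BilinForm.finrank_orthogonal hσnd Γ
    omega
  have hVd : finrank L (Vn ⧸ (LinearMap.BilinForm.orthogonal σ Γ)) = n - k := by
    have := Submodule.finrank_quotient_add_finrank (LinearMap.BilinForm.orthogonal σ Γ)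
    omega
  have hρinj : ∀ x ∈ W, (ρ.restrictScalars K) x = 0 → x = 0 := by
    intro w hw h0
    have hwO : w ∈ (LinearMap.BilinForm.orthogonal σ Γ) := (Submodule.Quotient.mk_eq_zero (LinearMap.BilinForm.orthogonal σ Γ)).mp h0
    by_contra hne
    have hΓker : Γ ≤ LinearMap.ker (σ w) := fun g hg => hσrefl _ _ (hwO g hg)
    set φ := Γ.liftQ (σ w) hΓker with hφ
    have hφπ : ∀ x, φ (π x) = σ w x := fun x => rfl
    set J : Finset (Fin t) := Finset.univ.filter fun i => ∃ u ∈ Us i, φ u ≠ 0 with hJ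
    have hJne : J.Nonempty := by
      rw [Finset.nonempty_iff_ne_empty]
      intro he
      apply hne
      refine hσ'nd w hw ?_
      have hle : W ≤ (LinearMap.ker (σ w)).restrictScalars K := by
        conv_lhs => rw [← hWsup]
        refine iSup_le fun j y hy => ?_
        by_contra hy0
        have : j ∈ J := Finset.mem_filter.mpr ⟨Finset.mem_univ _, π y, hy.2, hy0⟩
        simp [he] at this
      exact fun y hy => hle hy
    have h1 := hQ J hJne φ (fun i => by simp [hJ])
    have h2 : (⨆ i, Us i).map (φ.restrictScalars K) ≤ LinearMap.range (Algebra.linearMap K L) := by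
      rw [hUsup, hU]
      rintro _ ⟨_, ⟨y, hy, rfl⟩, rfl⟩
      obtain ⟨c, hc⟩ := hσW w hw y hy
      exact ⟨c, hc⟩
    have h3 := Submodule.finrank_mono h2
    have h4 := LinearMap.finrank_range_le (Algebra.linearMap K L)
    rw [finrank_self] at h4
    have h5 : ∑ i ∈ J, ks i < ∑ i ∈ J, ns i := Finset.sum_lt_sum_of_nonempty hJne fun i _ => hns i
    omega
  set Uds : Fin t → Submodule K (Vn ⧸ (LinearMap.BilinForm.orthogonal σ Γ)) := fun i => (Wd i).map (ρ.restrictScalars K) with hUds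
  have hUdsup : (⨆ i, Uds i) = Ud := by
    rw [hUd, ← hWdsup, Submodule.map_iSup]
  have hUdsn : ∀ i, finrank K (Uds i) = ns i := by
    intro i
    rw [← hWdn i]
    exact aux_finrank_map_eq _ _ fun x hx => hρinj x (hWdW i hx)
  have hUddim : finrank K Ud = n := by
    rw [hUd, aux_finrank_map_eq _ _ hρinj, hW]
  have hUdind : iSupIndep Uds :=
    (aux_dims Uds ns (fun i => (hUdsn i).le) (by rw [hUdsup, hUddim, hn])).1
  have hspan : ∀ i, Submodule.span L (Uds i : Set (Vn ⧸ (LinearMap.BilinForm.orthogonal σ Γ)))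
      = (LinearMap.BilinForm.orthogonal σ (E i)).map ρ := by
    intro i
    rw [← hWdspan i]
    exact aux_map_span ρ (Wd i)
  have hspanle : ∀ i, finrank L (Submodule.span L (Uds i : Set (Vn ⧸ (LinearMap.BilinForm.orthogonal σ Γ)))) ≤ ns i - ks i := by
    intro i
    rw [hspan i]
    have h1 := aux_rank_nullity ρ (LinearMap.BilinForm.orthogonal σ (E i))
    have h2 : finrank L (LinearMap.BilinForm.orthogonal σ (E i)) = _ :=
      LinearMap.BilinForm.finrank_orthogonal hσnd (E i)
    have h3 : finrank L (E i) = finrank K (N i) := aux_span_eq (L := L) W hWs (N i) (hNW i)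
    have h4 : LinearMap.BilinForm.orthogonal σ (E i ⊔ Γ) ≤
        LinearMap.BilinForm.orthogonal σ (E i) ⊓ LinearMap.ker ρ := by
      refine le_inf (LinearMap.BilinForm.orthogonal_le le_sup_left) ?_
      rw [hρ, Submodule.ker_mkQ]
      exact LinearMap.BilinForm.orthogonal_le le_sup_right
    have h5 := Submodule.finrank_mono h4
    have h6 : finrank L (LinearMap.BilinForm.orthogonal σ (E i ⊔ Γ)) = _ :=
      LinearMap.BilinForm.finrank_orthogonal hσnd (E i ⊔ Γ)
    -- dimension of `E i ⊔ Γ`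
    have h7 := aux_rank_nullity π (E i)
    have h8 := Submodule.finrank_sup_add_finrank_inf_eq (E i) Γ
    have h9 : LinearMap.ker π = Γ := by rw [hπ, Submodule.ker_mkQ]
    rw [h9] at h7
    have h10 : finrank L ((E i).map π) ≤ ∑ j ∈ Finset.univ.erase i, ks j := by
      have : (E i).map π = ⨆ j ∈ Finset.univ.erase i, Submodule.span L (Us j : Set (Vn ⧸ Γ)) := by
        simp only [hE, hN, aux_span_iSup, Submodule.map_iSup, ← aux_map_span, hmapWs]
      rw [this]
      have := aux_biSup_le (fun j => Submodule.span L (Us j : Set (Vn ⧸ Γ))) (Finset.univ.erase i)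
      simpa only [hFk] using this
    have h11 := Finset.add_sum_erase Finset.univ ks (Finset.mem_univ i)
    have h12 := hNd i
    have h13 := hns i
    omega
  have hspantop : (⨆ i, Submodule.span L (Uds i : Set (Vn ⧸ (LinearMap.BilinForm.orthogonal σ Γ)))) = ⊤ := by
    rw [← aux_span_iSup, hUdsup, hUd]
    have h1 : Submodule.span L (W : Set Vn) = ⊤ :=
      Submodule.eq_top_of_finrank_eq hstarV
    have h2 := aux_map_span (K := K) ρ W
    rw [h1, Submodule.map_top, hρ, Submodule.range_mkQ] at h2
    exact h2
  have hsumsub : ∑ i, (ns i - ks i) = n - k := by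
    have : ∑ i, (ns i - ks i) + ∑ i, ks i = ∑ i, ns i := by
      rw [← Finset.sum_add_distrib]
      exact Finset.sum_congr rfl fun i _ => Nat.sub_add_cancel (hns i).le
    omega
  obtain ⟨hspind, hspd⟩ := aux_dims (fun i => Submodule.span L (Uds i : Set (Vn ⧸ (LinearMap.BilinForm.orthogonal σ Γ))))
    (fun i => ns i - ks i) hspanle (by rw [hspantop, finrank_top, hVd]; exact hsumsub.le)
  -- representation of functionals
  have hrep : ∀ φ : (Vn ⧸ (LinearMap.BilinForm.orthogonal σ Γ)) →ₗ[L] L, ∃ v ∈ Γ, ∀ x, σ v x = φ (ρ x) := by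
    intro φ
    set v := (LinearMap.BilinForm.toDual σ hσnd).symm (φ ∘ₗ ρ) with hv
    have h1 : ∀ x, σ v x = φ (ρ x) := by
      intro x
      have := LinearMap.congr_fun
        ((LinearMap.BilinForm.toDual σ hσnd).apply_symm_apply (φ ∘ₗ ρ)) x
      rw [LinearMap.BilinForm.toDual_def] at this
      exact this
    refine ⟨v, ?_, h1⟩
    rw [← LinearMap.BilinForm.orthogonal_orthogonal hσnd hσrefl Γ]
    intro w hw
    apply hσrefl
    rw [h1 w]
    have : ρ w = 0 := (Submodule.Quotient.mk_eq_zero (LinearMap.BilinForm.orthogonal σ Γ)).mpr hw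
    rw [this, map_zero]
  -- the bound for functionals on the dual side
  have hQd : ∀ (φ : (Vn ⧸ (LinearMap.BilinForm.orthogonal σ Γ)) →ₗ[L] L) (J : Finset (Fin t)), J.Nonempty →
      (∀ j ∈ J, ∃ u ∈ Uds j, φ u ≠ 0) →
      ∑ i ∈ J, ks i + 1 ≤ finrank K (Ud.map (φ.restrictScalars K)) := by
    intro φ J hJ hφ
    obtain ⟨v, hv, hvφ⟩ := hrep φ
    have h1 := hD v hv J hJ (by
      intro j hj hvE
      obtain ⟨_, ⟨w, hw, rfl⟩, hne⟩ := hφ j hj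
      apply hne
      exact (hvφ w).symm.trans (hw.2 v hvE))
    have h2 : W.map ((σ v).restrictScalars K) = Ud.map (φ.restrictScalars K) := by
      rw [hUd, ← Submodule.map_comp]
      congr 1
      ext x
      exact hvφ x
    rwa [h2] at h1
  refine ⟨Uds, hUdind, hUdsup, hUdsn, hspind, hspantop, hspd, ?_, ?_, ?_⟩
  · intro i
    have h1 := hks i
    have h2 := hns i
    beta_reduce
    omega
  · intro i H hH hHd
    have hHd2 : finrank L H + 1 = ns i - ks i := hHd
    have hks1 := hks i
    have hns1 := hns i
    set T := H ⊔ ⨆ j ∈ Finset.univ.erase i, Submodule.span L (Uds j : Set (Vn ⧸ (LinearMap.BilinForm.orthogonal σ Γ))) with hT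
    have hTlt : T < ⊤ := by
      apply Submodule.lt_top_of_finrank_lt_finrank
      have h1 := Submodule.finrank_add_le_finrank_add_finrank H
        (⨆ j ∈ Finset.univ.erase i, Submodule.span L (Uds j : Set (Vn ⧸ (LinearMap.BilinForm.orthogonal σ Γ))))
      have h2 := aux_biSup_le (fun j => Submodule.span L (Uds j : Set (Vn ⧸ (LinearMap.BilinForm.orthogonal σ Γ))))
        (Finset.univ.erase i)
      simp only [hspd] at h2
      have h3 := Finset.add_sum_erase Finset.univ (fun i => ns i - ks i) (Finset.mem_univ i)
      beta_reduce at h3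
      rw [hVd, ← hsumsub, hT]
      omega
    obtain ⟨φ, hφ, hTφ⟩ := Submodule.exists_le_ker_of_lt_top T hTlt
    have h0 : ∀ j, j ≠ i → ∀ u ∈ Uds j, φ u = 0 := by
      intro j hj u hu
      apply hTφ
      refine Submodule.mem_sup_right ?_
      have : Submodule.span L (Uds j : Set (Vn ⧸ (LinearMap.BilinForm.orthogonal σ Γ))) ≤
          ⨆ j ∈ Finset.univ.erase i, Submodule.span L (Uds j : Set (Vn ⧸ (LinearMap.BilinForm.orthogonal σ Γ))) :=
        le_iSup₂_of_le (f := fun j _ => Submodule.span L (Uds j : Set (Vn ⧸ (LinearMap.BilinForm.orthogonal σ Γ)))) j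
          (by simp [hj]) le_rfl
      exact this (Submodule.subset_span hu)
    have hφi : ∃ u ∈ Uds i, φ u ≠ 0 := by
      by_contra! hc
      apply hφ
      rw [← LinearMap.ker_eq_top, eq_top_iff, ← hspantop]
      refine iSup_le fun j => Submodule.span_le.mpr fun u hu => ?_
      by_cases hj : j = i
      · subst hj; exact hc u hu
      · exact h0 j hj u hu
    have h1 := hQd φ {i} (Finset.singleton_nonempty i) (by
      intro j hj
      rw [Finset.mem_singleton.mp hj]; exact hφi)
    rw [Finset.sum_singleton] at h1
    have h2 : Ud.map (φ.restrictScalars K) ≤ (Uds i).map (φ.restrictScalars K) := by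
      rw [← hUdsup, Submodule.map_iSup]
      refine iSup_le fun j => ?_
      by_cases hj : j = i
      · rw [hj]
      · rintro _ ⟨u, hu, rfl⟩
        have : (φ.restrictScalars K) u = 0 := h0 j hj u hu
        rw [this]
        exact Submodule.zero_mem _
    have h3 := Submodule.finrank_mono h2
    have h4 := aux_rank_nullity (φ.restrictScalars K) (Uds i)
    have h5 : finrank K ↥(Uds i ⊓ H.restrictScalars K) ≤
        finrank K ↥(Uds i ⊓ LinearMap.ker (φ.restrictScalars K)) := by
      apply Submodule.finrank_mono
      refine inf_le_inf_left _ fun x hx => ?_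
      have : x ∈ T := Submodule.mem_sup_left hx
      exact hTφ this
    have h6 := hUdsn i
    omega
  · intro H hHd hH
    have hHlt : H < ⊤ := Submodule.lt_top_of_finrank_lt_finrank (by omega)
    obtain ⟨φ, hφ, hHφ⟩ := Submodule.exists_le_ker_of_lt_top H hHlt
    have hker : H = LinearMap.ker φ := by
      apply Submodule.eq_of_le_of_finrank_le hHφ
      have := Module.Dual.finrank_ker_add_one_of_ne_zero (K := L) hφ
      omega
    have h1 := hQd φ Finset.univ ⟨⟨0, ht⟩, Finset.mem_univ _⟩ (by
      intro j _
      by_contra! hc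
      exact hH j (Submodule.span_le.mpr fun u hu => by
        rw [hker]; exact hc u hu))
    have h4 := aux_rank_nullity (φ.restrictScalars K) Ud
    have h3 : LinearMap.ker (φ.restrictScalars K) = H.restrictScalars K := by rw [hker]; rfl
    rw [h3, hUddim] at h4
    rw [hsumsub]
    omega
end

section
/- Let C be a non-degenerate [n,k]_{q^m/q} code such that C^⊥ is non-degenerate, let U_C be an associated system, and suppose 0 = ε_0 < ε_{U_C}(t_1) = ε_1 < ⋯ < ε_{U_C}(t_{s−1}) = ε_{s−1} < ε_{U_C}(k) = n−k is the sequence of maximum non-zero defects of U_C (with t_0 = 0 and, for this code, t_s = k). Then: (i) for every r ∈ {1,…,k}, if t_i ≤ k−r < t_{i+1}, then d_r(C) = n − (k−r) − ε_i; (ii) for every r ∈ {1,…,n−k}, if j ∈ {1,…,s} is such that ε_{j−1} < r ≤ ε_j, then d_r(C^⊥) = r + t_j; (iii) consequently, {d_r(C^⊥) : 1 ≤ r ≤ n−k} = {1,…,n} ∖ {n+1−d_r(C) : 1 ≤ r ≤ k}. -/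
/-- The standard dot-product bilinear form on `ι → L`. -/
noncomputable def dotForm (L : Type*) [Field L] (ι : Type*) [Fintype ι] :
    (ι → L) →ₗ[L] (ι → L) →ₗ[L] L :=
  LinearMap.mk₂ L (fun x y => ∑ i, x i * y i)
    (fun x x' y => by simp [add_mul, Finset.sum_add_distrib])
    (fun c x y => by simp [Finset.mul_sum, mul_assoc])
    (fun x y y' => by simp [mul_add, Finset.sum_add_distrib])
    (fun c x y => by simp [Finset.mul_sum, mul_left_comm])

/-- The rank weight of a vector `v ∈ 𝔽_{q^m}^ι`. -/
noncomputable def rankWt (K : Type*) {L ι : Type*} [Field K] [Field L] [Algebra K L]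
    (v : ι → L) : ℕ :=
  Module.finrank K ↥(Submodule.span K (Set.range v))


/-- The `r`-th generalized rank weight of a code with associated system `U`:
`d_r = n − max{dim_{𝔽_q}(U ∩ T) : T an 𝔽_{q^m}-subspace of codimension r}`. -/
noncomputable def genWt {K : Type*} (L : Type*) {kk : ℕ} [Field K] [Field L] [Algebra K L]
    (n : ℕ) (U : Submodule K (Fin kk → L)) (r : ℕ) : ℤ :=
  (n : ℤ) - ((sSup {w : ℕ | ∃ T : Submodule L (Fin kk → L),
      Module.finrank L ↥T = kk - r ∧ w = wt U T} : ℕ) : ℤ)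

section Helpers

lemma aux_le_finrank {K V : Type*} [Field K] [AddCommGroup V] [Module K V] [Module.Finite K V]
    {w : ℕ} (p : Fin w → V) (hp : LinearIndependent K p) (S : Submodule K V) (h : ∀ i, p i ∈ S) :
    w ≤ Module.finrank K S := by
  have h1 : LinearIndependent K (fun i => (⟨p i, h i⟩ : S)) :=
    LinearIndependent.of_comp S.subtype (by simpa [Function.comp_def] using hp)
  simpa using h1.fintype_card_le_finrank

/-- existence of subspaces of a prescribed dimension above a given one -/
lemma aux_exists_ge {L V : Type*} [Field L] [AddCommGroup V] [Module L V] [Module.Finite L V]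
    (S : Submodule L V) (d : ℕ) (h1 : Module.finrank L S ≤ d) (h2 : d ≤ Module.finrank L V) :
    ∃ T : Submodule L V, S ≤ T ∧ Module.finrank L T = d := by
  induction d, h1 using Nat.le_induction with
  | base => exact ⟨S, le_rfl, rfl⟩
  | succ d hd ih =>
    obtain ⟨T, hST, hT⟩ := ih (by omega)
    have hne : T ≠ ⊤ := by
      rintro rfl
      rw [finrank_top] at hT
      omega
    obtain ⟨v, hv⟩ : ∃ v, v ∉ T := by
      by_contra hcon
      push Not at hcon
      exact hne (by ext; simp [hcon])
    refine ⟨T ⊔ Submodule.span L {v}, hST.trans le_sup_left, ?_⟩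
    have hv0 : v ≠ 0 := by rintro rfl; exact hv T.zero_mem
    have hinf : T ⊓ Submodule.span L {v} = ⊥ := by
      rw [Submodule.eq_bot_iff]
      rintro x ⟨hx, hx'⟩
      obtain ⟨c, rfl⟩ := Submodule.mem_span_singleton.1 hx'
      by_cases hc : c = 0
      · simp [hc]
      · exact absurd ((T.smul_mem_iff hc).1 hx) hv
    have := Submodule.finrank_sup_add_finrank_inf_eq T (Submodule.span L {v})
    rw [hinf, finrank_bot, finrank_span_singleton hv0] at this
    omega

variable {K L : Type*} [Field K] [Field L] [Algebra K L]

/-- A matrix with independent columns over `K` stays injective over `L`. -/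
lemma aux_inj {n w : ℕ} (P : Matrix (Fin n) (Fin w) K) (hP : LinearIndependent K P.col) :
    Function.Injective (Matrix.mulVecLin (P.map (algebraMap K L))) := by
  have h : Function.Injective P.mulVec := Matrix.mulVec_injective_iff.2 hP
  obtain ⟨q, hq⟩ := LinearMap.exists_leftInverse_of_injective P.mulVecLin
    (LinearMap.ker_eq_bot.2 h)
  have hQ : LinearMap.toMatrix' q * P = 1 := by
    have := congrArg LinearMap.toMatrix' hq
    rwa [LinearMap.toMatrix'_comp, ← Matrix.toLin'_apply', LinearMap.toMatrix'_toLin', LinearMap.toMatrix'_id] at this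
  have hQL : (LinearMap.toMatrix' q).map (algebraMap K L) * P.map (algebraMap K L) = 1 := by
    rw [← Matrix.map_mul, hQ]
    simp
  intro x y hxy
  simp only [Matrix.mulVecLin_apply] at hxy
  have := congrArg ((LinearMap.toMatrix' q).map (algebraMap K L)).mulVec hxy
  simpa [Matrix.mulVec_mulVec, hQL] using this

/-- The matrix duality step. -/
lemma aux_dual {n a b w : ℕ} (A : Matrix (Fin a) (Fin n) L) (B : Matrix (Fin b) (Fin n) L)
    (hAB : ∀ v, A.mulVec v = 0 → ∃ y, Matrix.vecMul y B = v)
    (P : Matrix (Fin n) (Fin w) K) (hP : LinearIndependent K P.col) :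
    ∃ P' : Matrix (Fin n) (Fin (n - w)) K, LinearIndependent K P'.col ∧
      (B * P'.map (algebraMap K L)).rank + w ≤ b + (A * P.map (algebraMap K L)).rank := by
  have hker : Module.finrank K (LinearMap.ker P.transpose.mulVecLin) = n - w := by
    have h1 := LinearMap.finrank_range_add_finrank_ker P.transpose.mulVecLin
    have h2 : P.transpose.rank = w := by
      rw [Matrix.rank_transpose, Matrix.rank_eq_finrank_span_cols,
        finrank_span_eq_card hP]
      simp
    rw [Matrix.rank] at h2
    simp at h1
    omega
  let bs := Module.finBasisOfFinrankEq K _ hker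
  let P' : Matrix (Fin n) (Fin (n - w)) K := Matrix.of fun i j => (bs j : Fin n → K) i
  have hP' : LinearIndependent K P'.col := by
    have := bs.linearIndependent.map' (Submodule.subtype _) (Submodule.ker_subtype _)
    exact this
  have hPP : P.transpose * P' = 0 := by
    ext i j
    have := (bs j).2
    rw [LinearMap.mem_ker, Matrix.mulVecLin_apply] at this
    exact congrFun this i
  have hPP2 : (P'.map (algebraMap K L)).transpose * P.map (algebraMap K L) = 0 := by
    have : P'.transpose * P = 0 := by
      rw [← Matrix.transpose_eq_zero, Matrix.transpose_mul, Matrix.transpose_transpose, hPP]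
    rw [← Matrix.transpose_map, ← Matrix.map_mul, this]
    simp
  refine ⟨P', hP', ?_⟩
  set PL := P.map (algebraMap K L)
  set PL' := P'.map (algebraMap K L)
  let N := LinearMap.ker (A * PL).mulVecLin
  let Y := (N.map PL.mulVecLin).comap B.transpose.mulVecLin
  have h1 : Module.finrank L N = Module.finrank L (N.map PL.mulVecLin) :=
    (LinearEquiv.finrank_eq (Submodule.equivMapOfInjective _ (aux_inj P hP) N))
  have h2 : Y.map B.transpose.mulVecLin = N.map PL.mulVecLin := by
    apply Submodule.map_comap_eq_of_le
    rintro _ ⟨x, hx, rfl⟩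
    have hx' : (A * PL).mulVec x = 0 := hx
    rw [← Matrix.mulVec_mulVec] at hx'
    obtain ⟨y, hy⟩ := hAB _ hx'
    refine ⟨y, ?_⟩
    simp [Matrix.mulVec_transpose, hy]
  have h3 : Module.finrank L (Y.map B.transpose.mulVecLin) ≤ Module.finrank L Y :=
    Submodule.finrank_map_le _ _
  have h4 : Y ≤ LinearMap.ker (B * PL').transpose.mulVecLin := by
    rintro y ⟨x, hx, hxy⟩
    rw [LinearMap.mem_ker, Matrix.mulVecLin_apply, Matrix.transpose_mul, ← Matrix.mulVec_mulVec]
    simp only [Matrix.mulVecLin_apply] at hxy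
    rw [← hxy, Matrix.mulVec_mulVec, hPP2, Matrix.zero_mulVec]
  have h5 := Submodule.finrank_mono h4
  have h6 := LinearMap.finrank_range_add_finrank_ker (B * PL').transpose.mulVecLin
  have h7 := LinearMap.finrank_range_add_finrank_ker (A * PL).mulVecLin
  have h8 := Matrix.rank_transpose (B * PL')
  rw [h2] at h3
  change _ + Module.finrank L N = _ at h7
  rw [Matrix.rank] at h8
  rw [← h8, Matrix.rank]
  simp only [Module.finrank_fin_fun] at h6 h7
  omega

lemma aux_comb {n a : ℕ} (A : Matrix (Fin a) (Fin n) L) (z : Fin n → K) :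
    Fintype.linearCombination K (fun j : Fin n => fun i : Fin a => A i j) z
      = A.mulVec (fun j => algebraMap K L (z j)) := by
  ext i
  simp [Fintype.linearCombination_apply, Matrix.mulVec, dotProduct, Algebra.smul_def, mul_comm]

lemma aux_colrange {n a w : ℕ} (A : Matrix (Fin a) (Fin n) L) (P : Matrix (Fin n) (Fin w) K) :
    (A * P.map (algebraMap K L)).col = fun i =>
      Fintype.linearCombination K (fun j : Fin n => fun i : Fin a => A i j) (P.col i) := by
  funext i
  rw [aux_comb]
  rfl

lemma aux_dual_step [Module.Finite K L] {n a b w d : ℕ}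
    (A : Matrix (Fin a) (Fin n) L) (B : Matrix (Fin b) (Fin n) L)
    (hAB : ∀ v, A.mulVec v = 0 → ∃ y, Matrix.vecMul y B = v)
    (hA : LinearIndependent K (fun j : Fin n => fun i : Fin a => A i j))
    (hB : LinearIndependent K (fun j : Fin n => fun i : Fin b => B i j))
    (UA : Submodule K (Fin a → L))
    (hUA : UA = Submodule.span K (Set.range (fun j : Fin n => fun i : Fin a => A i j)))
    (UB : Submodule K (Fin b → L))
    (hUB : UB = Submodule.span K (Set.range (fun j : Fin n => fun i : Fin b => B i j)))
    (T : Submodule L (Fin a → L)) (hw : w ≤ wt UA T) (hd : d ≤ b)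
    (hineq : b + Module.finrank L T ≤ d + w) :
    ∃ T' : Submodule L (Fin b → L), Module.finrank L T' = d ∧ n - w ≤ wt UB T' := by
  -- build P
  let gA := Fintype.linearCombination K (fun j : Fin n => fun i : Fin a => A i j)
  let gB := Fintype.linearCombination K (fun j : Fin n => fun i : Fin b => B i j)
  have hgA : LinearMap.range gA = UA := by rw [hUA]; exact Fintype.range_linearCombination _ _
  have hgB : LinearMap.range gB = UB := by rw [hUB]; exact Fintype.range_linearCombination _ _
  have hgBinj : LinearMap.ker gB = ⊥ := LinearMap.ker_eq_bot.2 hB.fintypeLinearCombination_injective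
  let bs := Module.finBasis K ↥(UA ⊓ T.restrictScalars K)
  have hbs : LinearIndependent K (fun i => (bs i : Fin a → L)) :=
    bs.linearIndependent.map' (Submodule.subtype _) (Submodule.ker_subtype _)
  have hpre : ∀ i, ∃ z, gA z = bs i := fun i => by
    have : ∀ v ∈ UA, ∃ z, gA z = v := fun v hv => by
      rw [← hgA] at hv
      exact hv
    exact this _ (bs i).2.1
  choose z hz using hpre
  have hzli : LinearIndependent K z := by
    refine LinearIndependent.of_comp gA ?_
    convert hbs using 1
    funext i
    exact hz i
  let P : Matrix (Fin n) (Fin w) K := Matrix.of fun i j => z (Fin.castLE hw j) i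
  have hP : LinearIndependent K P.col := hzli.comp _ (Fin.castLE_injective hw)
  obtain ⟨P', hP', hrk⟩ := aux_dual A B hAB P hP
  have hr1 : (A * P.map (algebraMap K L)).rank ≤ Module.finrank L T := by
    rw [Matrix.rank_eq_finrank_span_cols, aux_colrange]
    apply Submodule.finrank_mono
    rw [Submodule.span_le]
    rintro _ ⟨i, rfl⟩
    have : gA (P.col i) ∈ T := by
      have h : gA (P.col i) = bs (Fin.castLE hw i) := hz _
      rw [h]
      exact (bs _).2.2
    exact this
  obtain ⟨T', hT', hT'd⟩ := aux_exists_ge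
    (Submodule.span L (Set.range (B * P'.map (algebraMap K L)).col)) d
    (by rw [← Matrix.rank_eq_finrank_span_cols]; omega) (by simpa using hd)
  refine ⟨T', hT'd, ?_⟩
  refine aux_le_finrank (fun i => gB (P'.col i)) (hP'.map' gB hgBinj) _ fun i => ⟨?_, ?_⟩
  · rw [← hgB]; exact ⟨_, rfl⟩
  · apply hT'
    apply Submodule.subset_span
    refine ⟨i, ?_⟩
    rw [aux_colrange]

lemma aux_wt_le [Module.Finite K L] {a : ℕ} (U : Submodule K (Fin a → L))
    (T : Submodule L (Fin a → L)) : wt U T ≤ Module.finrank K (Fin a → L) :=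
  Submodule.finrank_le _

lemma aux_maxDefect_mem [Module.Finite K L] {a l : ℕ} (U : Submodule K (Fin a → L)) (hl : l ≤ a) :
    ∃ T : Submodule L (Fin a → L), Module.finrank L T = l ∧ maxDefect L U l = (wt U T : ℤ) - l := by
  have hne : {e : ℤ | ∃ T : Submodule L (Fin a → L), Module.finrank L ↥T = l ∧
      e = defect U T}.Nonempty := by
    obtain ⟨T, -, hT⟩ := aux_exists_ge (⊥ : Submodule L (Fin a → L)) l (by simp) (by simpa using hl)
    exact ⟨_, T, hT, rfl⟩
  have hbd : BddAbove {e : ℤ | ∃ T : Submodule L (Fin a → L), Module.finrank L ↥T = l ∧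
      e = defect U T} := by
    refine ⟨Module.finrank K (Fin a → L), ?_⟩
    rintro _ ⟨T, -, rfl⟩
    have := aux_wt_le U T
    unfold defect
    omega
  obtain ⟨T, hT, h⟩ := Int.csSup_mem hne hbd
  refine ⟨T, hT, ?_⟩
  rw [maxDefect, h, defect, hT]

lemma aux_le_maxDefect [Module.Finite K L] {a : ℕ} (U : Submodule K (Fin a → L))
    (T : Submodule L (Fin a → L)) :
    (wt U T : ℤ) - Module.finrank L T ≤ maxDefect L U (Module.finrank L T) := by
  refine le_csSup ⟨Module.finrank K (Fin a → L), ?_⟩ ⟨T, rfl, rfl⟩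
  rintro _ ⟨T, -, rfl⟩
  have := aux_wt_le U T
  unfold defect
  omega

lemma aux_genWt {a n r M : ℕ} (U : Submodule K (Fin a → L))
    (h1 : ∃ T : Submodule L (Fin a → L), Module.finrank L T = a - r ∧ M ≤ wt U T)
    (h2 : ∀ T : Submodule L (Fin a → L), Module.finrank L T = a - r → wt U T ≤ M) :
    genWt L n U r = (n : ℤ) - M := by
  obtain ⟨T, hT, hM⟩ := h1
  have : IsGreatest {w : ℕ | ∃ T : Submodule L (Fin a → L),
      Module.finrank L ↥T = a - r ∧ w = wt U T} M := by
    refine ⟨⟨T, hT, le_antisymm hM (h2 T hT)⟩, ?_⟩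
    rintro _ ⟨T, hT, rfl⟩
    exact h2 T hT
  rw [genWt, this.csSup_eq]

lemma aux_locate (g : ℕ → ℕ) (s x : ℕ) (h0 : g 0 < x) (hs : x ≤ g s) :
    ∃ i < s, g i < x ∧ x ≤ g (i + 1) := by
  induction s with
  | zero => omega
  | succ s ih =>
    by_cases h : x ≤ g s
    · obtain ⟨i, hi, h'⟩ := ih h
      exact ⟨i, by omega, h'⟩
    · exact ⟨s, by omega, by omega, hs⟩

lemma aux_mono (g : ℕ → ℕ) (s : ℕ) (h : ∀ i < s, g i < g (i + 1)) (i j : ℕ) (hij : i ≤ j)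
    (hj : j ≤ s) : g i ≤ g j := by
  induction j, hij using Nat.le_induction with
  | base => exact le_rfl
  | succ j hj' ih => exact (ih (by omega)).trans (h j (by omega)).le

end Helpers

/-- Theorem 2.20: generalized rank weights of `C` and `C^⊥` from the sequence of
maximum non-zero defects of `U_C`, and Wei-type duality. -/
theorem statement17 {K L : Type*} [Field K] [Field L] [Algebra K L]
    [Fintype K] [Fintype L]
    (m n k : ℕ) (hm : 0 < m) (hmL : Module.finrank K L = m)
    (hk : 0 < k) (hkn : k < n)
    (C : Submodule L (Fin n → L)) (hCdim : Module.finrank L ↥C = k)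
    (G : Matrix (Fin k) (Fin n) L)
    (hG : LinearMap.range (Matrix.vecMulLinear G) = C)
    (Cperp : Submodule L (Fin n → L))
    (hCperp : Cperp = LinearMap.BilinForm.orthogonal (dotForm L (Fin n)) C)
    -- `C` and `C^⊥` are non-degenerate
    (hCnd : LinearIndependent K (fun j : Fin n => fun i : Fin k => G i j))
    (hCperpnd : ∀ z : Fin n → K,
      (∀ c ∈ Cperp, ∑ i, algebraMap K L (z i) * c i = 0) → z = 0)
    -- the system associated with `C`
    (UC : Submodule K (Fin k → L))
    (hUC : UC = Submodule.span K (Set.range (fun j : Fin n => fun i : Fin k => G i j)))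
    -- a system associated with `C^⊥` (via a generator matrix `G'` of `C^⊥`)
    (G' : Matrix (Fin (n - k)) (Fin n) L)
    (hG' : LinearMap.range (Matrix.vecMulLinear G') = Cperp)
    (UCp : Submodule K (Fin (n - k) → L))
    (hUCp : UCp = Submodule.span K (Set.range (fun j : Fin n => fun i : Fin (n - k) => G' i j)))
    -- the sequence of maximum non-zero defects of `U_C`:
    -- `0 = ε_0 < ε_{U_C}(t_1) = ε_1 < ⋯ < ε_{U_C}(t_{s−1}) = ε_{s−1} < ε_{U_C}(k) = n−k`
    (s : ℕ) (hs : 0 < s) (ts e : ℕ → ℕ)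
    (ht0 : ts 0 = 0) (he0 : e 0 = 0)
    (htmono : ∀ i < s, ts i < ts (i + 1)) (htk : ts s = k)
    (hemono : ∀ i < s, e i < e (i + 1)) (hlast : e s = n - k)
    (hval : ∀ i ≤ s, maxDefect L UC (ts i) = (e i : ℤ))
    (hplateau : ∀ i < s, ∀ l : ℕ, ts i ≤ l → l < ts (i + 1) →
      maxDefect L UC l = (e i : ℤ)) :
    -- (i) `d_r(C) = n − (k−r) − ε_i` whenever `t_i ≤ k−r < t_{i+1}`
    (∀ r : ℕ, 1 ≤ r → r ≤ k → ∀ i : ℕ, i < s → ts i ≤ k - r → k - r < ts (i + 1) →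
      genWt L n UC r = (n : ℤ) - ((k - r : ℕ) : ℤ) - (e i : ℤ)) ∧
    -- (ii) `d_r(C^⊥) = r + t_j` whenever `ε_{j−1} < r ≤ ε_j`
    (∀ r : ℕ, 1 ≤ r → r ≤ n - k → ∀ j : ℕ, 1 ≤ j → j ≤ s →
      e (j - 1) < r → r ≤ e j →
      genWt L n UCp r = (r : ℤ) + (ts j : ℤ)) ∧
    -- (iii) Wei-type duality
    {x : ℤ | ∃ r : ℕ, 1 ≤ r ∧ r ≤ n - k ∧ x = genWt L n UCp r} =
      Set.Icc (1 : ℤ) (n : ℤ) \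
        {x : ℤ | ∃ r : ℕ, 1 ≤ r ∧ r ≤ k ∧ x = (n : ℤ) + 1 - genWt L n UC r} := by
  
  haveI : Module.Finite K L := Module.Finite.of_finite
  have htm := aux_mono ts s htmono
  have hem := aux_mono e s hemono
  have hAB : ∀ v, G.mulVec v = 0 → ∃ y, Matrix.vecMul y G' = v := by
    intro v hv
    have : v ∈ Cperp := by
      rw [hCperp, LinearMap.BilinForm.mem_orthogonal_iff]
      rintro c hc
      rw [← hG] at hc
      obtain ⟨y, rfl⟩ := hc
      change Matrix.vecMul y G ⬝ᵥ v = 0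
      rw [← Matrix.dotProduct_mulVec, hv, dotProduct_zero]
    rw [← hG'] at this
    exact this
  have hBA : ∀ v, G'.mulVec v = 0 → ∃ y, Matrix.vecMul y G = v := by
    intro v hv
    have hv' : v ∈ LinearMap.BilinForm.orthogonal (dotForm L (Fin n)) Cperp := by
      rw [LinearMap.BilinForm.mem_orthogonal_iff]
      rintro c hc
      rw [← hG'] at hc
      obtain ⟨y, rfl⟩ := hc
      change Matrix.vecMul y G' ⬝ᵥ v = 0
      rw [← Matrix.dotProduct_mulVec, hv, dotProduct_zero]
    have hrefl : LinearMap.IsRefl (dotForm L (Fin n)) := by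
      intro x y hxy
      change y ⬝ᵥ x = 0
      rw [dotProduct_comm]
      exact hxy
    have hnd : LinearMap.Nondegenerate (dotForm L (Fin n)) := by
      refine ⟨fun x hx => ?_, fun x hx => ?_⟩
      · exact dotProduct_eq_zero_iff.1 hx
      · refine dotProduct_eq_zero_iff.1 fun y => ?_
        rw [dotProduct_comm]; exact hx y
    rw [hCperp, LinearMap.BilinForm.orthogonal_orthogonal hnd hrefl, ← hG] at hv'
    exact hv'
  have hBnd : LinearIndependent K (fun j : Fin n => fun i : Fin (n - k) => G' i j) := by
    rw [Fintype.linearIndependent_iff]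
    intro z hz
    refine congrFun (hCperpnd z ?_)
    intro c hc
    rw [← hG'] at hc
    obtain ⟨y, rfl⟩ := hc
    have h := aux_comb G' z
    rw [Fintype.linearCombination_apply, hz] at h
    change (fun i => algebraMap K L (z i)) ⬝ᵥ Matrix.vecMul y G' = 0
    rw [dotProduct_comm, ← Matrix.dotProduct_mulVec, ← h, dotProduct_zero]
  have hI : ∀ r : ℕ, 1 ≤ r → r ≤ k → ∀ i : ℕ, i < s → ts i ≤ k - r → k - r < ts (i + 1) →
      genWt L n UC r = (n : ℤ) - ((k - r : ℕ) : ℤ) - (e i : ℤ) := by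
    intro r hr1 hrk i hi h1 h2
    have hp := hplateau i hi _ h1 h2
    rw [aux_genWt (M := (k - r) + e i)]
    · push_cast; ring
    · obtain ⟨T, hT, h⟩ := aux_maxDefect_mem (l := k - r) UC (by omega)
      exact ⟨T, hT, by omega⟩
    · intro T hT
      have := aux_le_maxDefect UC T
      rw [hT] at this
      omega
  have hII : ∀ r : ℕ, 1 ≤ r → r ≤ n - k → ∀ j : ℕ, 1 ≤ j → j ≤ s →
      e (j - 1) < r → r ≤ e j → genWt L n UCp r = (r : ℤ) + (ts j : ℤ) := by
    intro r hr1 hrk j hj1 hjs h1 h2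
    have htjk : ts j ≤ k := htk ▸ htm j s hjs le_rfl
    have htj : ts (j - 1) < ts j := by
      have := htmono (j - 1) (by omega)
      rwa [Nat.sub_add_cancel hj1] at this
    rw [aux_genWt (M := n - r - ts j)]
    · omega
    · obtain ⟨T, hT, h⟩ := aux_maxDefect_mem (l := ts j) UC htjk
      rw [hval j hjs] at h
      obtain ⟨T', hT', h'⟩ := aux_dual_step (w := ts j + r) (d := n - k - r) G G' hAB hCnd hBnd
        UC hUC UCp hUCp T (by omega) (by omega) (by omega)
      exact ⟨T', hT', by omega⟩
    · intro T' hT'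
      by_contra hcon
      obtain ⟨T, hT, h⟩ := aux_dual_step (w := n - r - ts j + 1) (d := ts j - 1) G' G hBA hBnd hCnd
        UCp hUCp UC hUC T' (by omega) (by omega) (by omega)
      have h3 := aux_le_maxDefect UC T
      have h4 := hplateau (j - 1) (by omega) (ts j - 1) (by omega)
        (by rw [Nat.sub_add_cancel hj1]; omega)
      rw [hT, h4] at h3
      omega
  refine ⟨hI, hII, ?_⟩
  ext x
  simp only [Set.mem_setOf_eq, Set.mem_diff, Set.mem_Icc]
  constructor
  · rintro ⟨r, hr1, hrk, rfl⟩
    obtain ⟨i, his, hi1, hi2⟩ := aux_locate e s r (by omega) (by omega)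
    rw [hII r hr1 hrk (i + 1) (by omega) (by omega) (by simpa using hi1) hi2]
    have htjk : ts (i + 1) ≤ k := htk ▸ htm (i + 1) s (by omega) le_rfl
    refine ⟨⟨by omega, by omega⟩, ?_⟩
    rintro ⟨r', hr1', hrk', h⟩
    obtain ⟨i', his', hi1', hi2'⟩ := aux_locate ts s (k - r' + 1) (by omega) (by omega)
    rw [hI r' hr1' hrk' i' his' (by omega) (by omega)] at h
    rcases le_or_gt (i + 1) i' with hc | hc
    · have := htm _ _ hc (by omega)
      have := hem _ _ hc (by omega)
      omega
    · have := htm (i' + 1) (i + 1) (by omega) (by omega)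
      have := hem i' i (by omega) (by omega)
      omega
  · rintro ⟨⟨hx1, hxn⟩, hx⟩
    lift x to ℕ using by omega
    obtain ⟨i, his, hi1, hi2⟩ := aux_locate (fun i => ts i + e i) s x
      (by omega) (by omega)
    have htjk : ts (i + 1) ≤ k := htk ▸ htm (i + 1) s (by omega) le_rfl
    have hejk : e (i + 1) ≤ n - k := hlast ▸ hem (i + 1) s (by omega) le_rfl
    rcases le_or_gt x (ts (i + 1) + e i) with hc | hc
    · refine absurd ⟨k - (x - 1 - e i), by omega, by omega, ?_⟩ hx
      rw [hI _ (by omega) (by omega) i his (by omega) (by omega)]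
      omega
    · refine ⟨x - ts (i + 1), by omega, by omega, ?_⟩
      rw [hII _ (by omega) (by omega) (i + 1) (by omega) (by omega)
        (by simp only [Nat.add_sub_cancel]; omega) (by omega)]
      omega
end

section
/- Let 𝐤 = (k_1,…,k_t) and 𝐧 = (n_1,…,n_t) with k_i < n_i ≤ m for all i, N = n_1+⋯+n_t and K = k_1+⋯+k_t, and let C be an [N,K]_{q^m/q} code. Then C is an (𝐧,𝐤)-MRD code if and only if C^⊥ is an (𝐧,𝐧−𝐤)-MRD code, where 𝐧−𝐤 = (n_1−k_1,…,n_t−k_t). -/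
/-- The minimum rank distance of a code `C`. -/
noncomputable def minRankDist (K : Type*) {L ι : Type*} [Field K] [Field L] [Algebra K L]
    (C : Submodule L (ι → L)) : ℕ :=
  sInf {w : ℕ | ∃ c ∈ C, c ≠ 0 ∧ w = rankWt K c}

/-- `C` is an `[nn, kk]_{q^m/q}` MRD code (for block length `nn ≤ m`, where the
Singleton bound reads `d ≤ nn − kk + 1`). -/
def IsMRDCode (K : Type*) {L : Type*} [Field K] [Field L] [Algebra K L]
    {nn : ℕ} (kk : ℕ) (C : Submodule L (Fin nn → L)) : Prop :=
  Module.finrank L ↥C = kk ∧ minRankDist K C = nn - kk + 1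

/-- `C ⊆ 𝔽_{q^m}^N` (coordinates indexed by the disjoint blocks `Fin (ns i)`)
is an `(𝐧,𝐤)`-MRD code: `C = C_1 ⊕ ⋯ ⊕ C_t` with each `C_i` an
`[n_i,k_i]_{q^m/q}` MRD code, and every codeword whose components are all
non-zero has rank weight at least `N − K + 1`. -/
def IsNKMRD (K : Type*) {L : Type*} [Field K] [Field L] [Algebra K L]
    {t : ℕ} (ns ks : Fin t → ℕ)
    (C : Submodule L (((i : Fin t) × Fin (ns i)) → L)) : Prop :=
  ∃ Cs : (i : Fin t) → Submodule L (Fin (ns i) → L),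
    (∀ i, IsMRDCode K (ks i) (Cs i)) ∧
    C = ⨅ i, (Cs i).comap
      (LinearMap.funLeft L L (fun j : Fin (ns i) => (⟨i, j⟩ : (i : Fin t) × Fin (ns i)))) ∧
    (∀ x ∈ C, (∀ i, (fun j : Fin (ns i) => x ⟨i, j⟩) ≠ 0) →
      (∑ i, ns i) - (∑ i, ks i) + 1 ≤ rankWt K x)

open Module

section helpers
variable {K L : Type*} [Field K] [Field L] [Algebra K L]

theorem rankWt_eq {κ : Type*} [Fintype κ] (x : κ → L) :
    rankWt K x = finrank K (LinearMap.range (Fintype.linearCombination K x)) := by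
  rw [rankWt, Fintype.range_linearCombination]

theorem rank_lemA {κ : Type*} [Fintype κ] {k : ℕ} (M : Matrix (Fin k) κ K) (x : κ → L)
    (h : ∀ l, ∑ p, M l p • x p = 0) : rankWt K x + M.rank ≤ Fintype.card κ := by
  classical
  rw [rankWt_eq, ← Matrix.rank_transpose, Matrix.rank]
  have h1 := LinearMap.finrank_range_add_finrank_ker (Fintype.linearCombination K x)
  rw [Module.finrank_fintype_fun_eq_card] at h1
  have h2 : LinearMap.range M.transpose.mulVecLin ≤
      LinearMap.ker (Fintype.linearCombination K x) := by
    rw [Matrix.range_mulVecLin, Submodule.span_le]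
    rintro _ ⟨l, rfl⟩
    simpa [Fintype.linearCombination_apply] using h l
  have := Submodule.finrank_mono h2
  omega

theorem rank_lemB {κ : Type*} [Fintype κ] {k : ℕ} (M : Matrix (Fin k) κ K) (y : κ → L)
    (u : Fin k → L) (h : ∀ p, y p = ∑ l, M l p • u l) : rankWt K y ≤ M.rank := by
  classical
  rw [rankWt_eq, Matrix.rank]
  have : Fintype.linearCombination K y =
      (Fintype.linearCombination K u).comp M.mulVecLin := by
    apply LinearMap.pi_ext'
    intro p
    ext
    simp [Fintype.linearCombination_apply, h, Pi.single_apply, ite_smul]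
  rw [this, LinearMap.range_comp]
  exact Submodule.finrank_map_le _ _

theorem rank_lemC {κ : Type*} [Fintype κ] {k : ℕ} (y : κ → L)
    (h : rankWt K y ≤ k) (hk : k ≤ Fintype.card κ) :
    ∃ (M : Matrix (Fin k) κ K) (u : Fin k → L), M.rank = k ∧
      ∀ p, y p = ∑ l, M l p • u l := by
  classical
  rw [rankWt_eq] at h
  have h1 := LinearMap.finrank_range_add_finrank_ker (Fintype.linearCombination K y)
  rw [Module.finrank_fintype_fun_eq_card] at h1
  obtain ⟨f, hf⟩ := exists_linearIndependent_of_le_finrank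
    (R := K) (M := LinearMap.ker (Fintype.linearCombination K y)) (n := Fintype.card κ - k)
    (by omega)
  have hf' := hf.map' (Submodule.subtype _) (Submodule.ker_subtype _)
  set W := Submodule.span K (Set.range (Submodule.subtype _ ∘ f)) with hW
  have hWd : finrank K W = Fintype.card κ - k := by
    rw [hW, finrank_span_eq_card hf', Fintype.card_fin]
  have hWle : W ≤ LinearMap.ker (Fintype.linearCombination K y) := by
    rw [hW, Submodule.span_le]
    rintro _ ⟨l, rfl⟩
    exact (f l).2
  have hq : finrank K ((κ → K) ⧸ W) = finrank K (Fin k → K) := by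
    have := Submodule.finrank_quotient_add_finrank W
    rw [Module.finrank_fintype_fun_eq_card] at this
    simp
    omega
  let e := LinearEquiv.ofFinrankEq _ _ hq
  let A : (κ → K) →ₗ[K] (Fin k → K) := e.toLinearMap.comp W.mkQ
  let g : (Fin k → K) →ₗ[K] L := (W.liftQ _ hWle).comp e.symm.toLinearMap
  have hg : ∀ v, g (A v) = Fintype.linearCombination K y v := by
    intro v; simp [g, A]
  refine ⟨LinearMap.toMatrix' A, fun l => g (Pi.single l 1), ?_, ?_⟩
  · rw [Matrix.rank, ← Matrix.toLin'_apply']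
    rw [show LinearMap.range _ = ⊤ from ?_]
    · simp
    · rw [Matrix.toLin'_toMatrix', LinearMap.range_eq_top]
      exact e.surjective.comp W.mkQ_surjective
  · intro p
    have := hg (Pi.single p 1)
    rw [Fintype.linearCombination_apply_single, one_smul] at this
    rw [← this, LinearMap.pi_apply_eq_sum_univ g]
    refine Finset.sum_congr rfl fun l _ => ?_
    rw [LinearMap.toMatrix'_apply]
    congr 3
    · ext; simp [Pi.single_apply, eq_comm]

theorem dotForm_apply' {ι : Type*} [Fintype ι] (x y : ι → L) :
    dotForm L ι x y = ∑ i, x i * y i := rfl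

theorem dotForm_refl {ι : Type*} [Fintype ι] : (dotForm L ι).IsRefl := by
  intro x y h
  rw [dotForm_apply'] at *
  rw [← h]; exact Finset.sum_congr rfl fun _ _ => mul_comm _ _

theorem dotForm_nondeg {ι : Type*} [Fintype ι] : (dotForm L ι).Nondegenerate := by
  classical
  constructor
  · intro x h
    ext i
    simpa [dotForm_apply', Pi.single_apply] using h (Pi.single i 1)
  · intro x h
    ext i
    simpa [dotForm_apply', Pi.single_apply] using h (Pi.single i 1)

end helpers

section blocks
variable {K L : Type*} [Field K] [Field L] [Algebra K L] [FiniteDimensional K L]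
  {t : ℕ} {ns ks : Fin t → ℕ}

theorem card_blocks (S : Finset (Fin t)) :
    Fintype.card {p : (i : Fin t) × Fin (ns i) // p.1 ∈ S} = ∑ i ∈ S, ns i := by
  classical
  rw [Fintype.card_subtype]
  have : (Finset.univ.filter fun p : (i : Fin t) × Fin (ns i) => p.1 ∈ S) =
      S.sigma (fun i => (Finset.univ : Finset (Fin (ns i)))) := by
    ext p; simp
  rw [this, Finset.card_sigma]
  simp

theorem rankWt_univ (x : ((i : Fin t) × Fin (ns i)) → L) :
    rankWt K (fun p : {p : (i : Fin t) × Fin (ns i) // p.1 ∈ Finset.univ} => x p.1)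
      = rankWt K x := by
  have : Set.range (fun p : {p : (i : Fin t) × Fin (ns i) // p.1 ∈ Finset.univ} => x p.1)
      = Set.range x := by
    ext v
    constructor
    · rintro ⟨p, rfl⟩
      exact ⟨p.1, rfl⟩
    · rintro ⟨p, rfl⟩
      exact ⟨⟨p, Finset.mem_univ _⟩, rfl⟩
  rw [rankWt, rankWt, this]

/-- Every restriction of an (n,k)-MRD code to a set of blocks satisfies the weight bound. -/
theorem restrict_bound (Cs : (i : Fin t) → Submodule L (Fin (ns i) → L))
    (hmin : ∀ i, ∃ c ∈ Cs i, c ≠ 0 ∧ rankWt K c + ks i = ns i + 1)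
    (hfull : ∀ x : ((i : Fin t) × Fin (ns i)) → L, (∀ i, (fun j => x ⟨i, j⟩) ∈ Cs i) →
      (∀ i, (fun j => x ⟨i, j⟩) ≠ 0) → ∑ i, ns i + 1 ≤ rankWt K x + ∑ i, ks i) :
    ∀ n : ℕ, ∀ S : Finset (Fin t), (Sᶜ).card = n → S.Nonempty →
      ∀ x : ((i : Fin t) × Fin (ns i)) → L, (∀ i, (fun j => x ⟨i, j⟩) ∈ Cs i) →
      (∀ i ∈ S, (fun j => x ⟨i, j⟩) ≠ 0) →
      ∑ i ∈ S, ns i + 1 ≤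
        rankWt K (fun p : {p : (i : Fin t) × Fin (ns i) // p.1 ∈ S} => x p.1) + ∑ i ∈ S, ks i := by
  classical
  intro n
  induction n with
  | zero =>
    intro S hS _ x hx hx0
    have hS : S = Finset.univ := by simpa using hS
    subst hS
    have := hfull x hx (fun i => hx0 i (Finset.mem_univ i))
    have e : rankWt K (fun p : {p : (i : Fin t) × Fin (ns i) // p.1 ∈ Finset.univ} => x p.1)
        = rankWt K x := by
      exact rankWt_univ _
    rw [e]
    exact this
  | succ n ih =>
    intro S hS hne x hx hx0
    obtain ⟨j, hj⟩ : (Sᶜ).Nonempty := by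
      rw [← Finset.card_pos]; omega
    have hjS : j ∉ S := by simpa using hj
    obtain ⟨c, hc, hc0, hcr⟩ := hmin j
    obtain ⟨i0, hi0⟩ := hne
    obtain ⟨j0, hj0⟩ := Function.ne_iff.mp (hx0 i0 hi0)
    obtain ⟨j1, hj1⟩ := Function.ne_iff.mp hc0
    simp only [Pi.zero_apply] at hj0 hj1
    set a : L := x ⟨i0, j0⟩ / c j1 with ha
    have ha0 : a ≠ 0 := div_ne_zero hj0 hj1
    have hac : a * c j1 = x ⟨i0, j0⟩ := div_mul_cancel₀ _ hj1
    let z : (i : Fin t) → Fin (ns i) → L :=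
      Function.update (fun i j => x ⟨i, j⟩) j (a • c)
    have hzj : z j = a • c := Function.update_self ..
    have hzi : ∀ i, i ≠ j → z i = fun j => x ⟨i, j⟩ := fun i h => Function.update_of_ne h ..
    have hac0 : a • c ≠ 0 := smul_ne_zero ha0 hc0
    have key := ih (insert j S) (by
        have h1 := Finset.card_compl_add_card S
        have h2 := Finset.card_compl_add_card (insert j S)
        rw [Finset.card_insert_of_notMem hjS] at h2
        omega) (Finset.insert_nonempty _ _) (fun p => z p.1 p.2) (by
        intro i
        by_cases h : i = j
        · subst h
          change z i ∈ _
          rw [hzj]; exact Submodule.smul_mem _ _ hc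
        · change z i ∈ _
          rw [hzi i h]; exact hx i) (by
        intro i hi
        change z i ≠ 0
        by_cases h : i = j
        · subst h
          rw [hzj]; exact hac0
        · rw [hzi i h]; exact hx0 i (by simpa [h] using hi))
    rw [Finset.sum_insert hjS, Finset.sum_insert hjS] at key
    set X := Submodule.span K (Set.range
      (fun p : {p : (i : Fin t) × Fin (ns i) // p.1 ∈ S} => x p.1)) with hX
    set Y := Submodule.span K (Set.range (a • c)) with hY
    have hYr : finrank K Y ≤ rankWt K c := by
      have : Y = (Submodule.span K (Set.range c)).map (LinearMap.mulLeft K a) := by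
        rw [Submodule.map_span, ← Set.range_comp, hY]; rfl
      rw [this]
      exact Submodule.finrank_map_le _ _
    have hle : rankWt K (fun p : {p : (i : Fin t) × Fin (ns i) // p.1 ∈ insert j S} =>
        z p.1.1 p.1.2) ≤ finrank K ↥(X ⊔ Y) := by
      apply Submodule.finrank_mono
      rw [Submodule.span_le]
      rintro _ ⟨⟨⟨i, l⟩, hi⟩, rfl⟩
      dsimp only at hi ⊢
      by_cases h : i = j
      · subst h
        rw [hzj]
        exact Submodule.mem_sup_right (Submodule.subset_span ⟨l, rfl⟩)
      · rw [hzi i h]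
        have hi' : i ∈ S := by simpa [h] using hi
        exact Submodule.mem_sup_left (Submodule.subset_span ⟨⟨⟨i, l⟩, hi'⟩, rfl⟩)
    have hpos : 0 < finrank K ↥(X ⊓ Y) := by
      rw [Module.finrank_pos_iff_exists_ne_zero]
      refine ⟨⟨x ⟨i0, j0⟩, Submodule.subset_span ⟨⟨⟨i0, j0⟩, hi0⟩, rfl⟩,
        Submodule.subset_span ⟨j1, hac⟩⟩, ?_⟩
      simpa [Subtype.ext_iff] using hj0
    have hsum := Submodule.finrank_sup_add_finrank_inf_eq X Y
    have hXr : rankWt K (fun p : {p : (i : Fin t) × Fin (ns i) // p.1 ∈ S} => x p.1)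
      = finrank K X := rfl
    omega

/-- The dual weight bound. -/
theorem dual_bound (Cs : (i : Fin t) → Submodule L (Fin (ns i) → L))
    (hdim : ∀ i, finrank L (Cs i) = ks i) (hkn : ∀ i, ks i ≤ ns i)
    (hP : ∀ S : Finset (Fin t), S.Nonempty →
      ∀ x : ((i : Fin t) × Fin (ns i)) → L, (∀ i, (fun j => x ⟨i, j⟩) ∈ Cs i) →
      (∀ i ∈ S, (fun j => x ⟨i, j⟩) ≠ 0) →
      ∑ i ∈ S, ns i + 1 ≤
        rankWt K (fun p : {p : (i : Fin t) × Fin (ns i) // p.1 ∈ S} => x p.1) + ∑ i ∈ S, ks i)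
    (y : ((i : Fin t) × Fin (ns i)) → L)
    (hy : ∀ i, ∀ c ∈ Cs i, ∑ j, c j * y ⟨i, j⟩ = 0)
    (S : Finset (Fin t)) :
    S.Nonempty → (∀ i ∈ S, (fun j => y ⟨i, j⟩) ≠ 0) →
    ∑ i ∈ S, ks i + 1 ≤
        rankWt K (fun p : {p : (i : Fin t) × Fin (ns i) // p.1 ∈ S} => y p.1) := by
  classical
  induction S using Finset.strongInduction with
  | H S ih =>
  intro hne hy0
  by_contra hcon
  obtain ⟨M, u, hM, hyM⟩ := rank_lemC (K := K) (k := ∑ i ∈ S, ks i)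
    (fun p : {p : (i : Fin t) × Fin (ns i) // p.1 ∈ S} => y p.1) (by omega)
    (by rw [card_blocks]; exact Finset.sum_le_sum fun i _ => hkn i)
  have hu : u ≠ 0 := by
    rintro rfl
    obtain ⟨i, hi⟩ := hne
    apply hy0 i hi
    ext j
    simpa using hyM ⟨⟨i, j⟩, hi⟩
  -- the space of codewords supported on `S`
  let B : ((i : S) → Cs i) →ₗ[L] (Fin (∑ i ∈ S, ks i) → L) :=
    { toFun := fun x l => ∑ p : {p : (i : Fin t) × Fin (ns i) // p.1 ∈ S},
        M l p • (x ⟨p.1.1, p.2⟩ : Fin (ns p.1.1) → L) p.1.2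
      map_add' := fun x x' => by
        ext l; simp [smul_add, Finset.sum_add_distrib]
      map_smul' := fun a x => by
        ext l
        simp only [Pi.smul_apply, Submodule.coe_smul, RingHom.id_apply, smul_eq_mul,
          Finset.mul_sum, mul_smul_comm] }
  have hB : ∀ x, ∑ l, B x l * u l = 0 := by
    intro x
    have h1 : ∑ l, B x l * u l = ∑ p : {p : (i : Fin t) × Fin (ns i) // p.1 ∈ S},
        (x ⟨p.1.1, p.2⟩ : Fin (ns p.1.1) → L) p.1.2 * y p.1 := by
      simp only [hyM, B, LinearMap.coe_mk, AddHom.coe_mk, Finset.sum_mul, Finset.mul_sum]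
      rw [Finset.sum_comm]
      refine Finset.sum_congr rfl fun p _ => Finset.sum_congr rfl fun l _ => ?_
      rw [smul_mul_assoc, mul_smul_comm]
    rw [h1]
    let F : ((i : Fin t) × Fin (ns i)) → L := fun p =>
      if h : p.1 ∈ S then (x ⟨p.1, h⟩ : Fin (ns p.1) → L) p.2 * y p else 0
    have h2 : ∑ p : {p : (i : Fin t) × Fin (ns i) // p.1 ∈ S},
        (x ⟨p.1.1, p.2⟩ : Fin (ns p.1.1) → L) p.1.2 * y p.1 = ∑ p, F p := by
      refine Fintype.sum_of_injective _ Subtype.val_injective _ _ ?_ ?_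
      · intro p hp
        have : p.1 ∉ S := by simpa using hp
        simp [F, this]
      · intro p
        simp [F, p.2]
    rw [h2, Fintype.sum_sigma]
    refine Finset.sum_eq_zero fun i _ => ?_
    by_cases h : i ∈ S
    · simpa [F, h] using hy i _ (x ⟨i, h⟩).2
    · simp [F, h]
  have hns : ¬ Function.Surjective B := by
    intro hs
    apply hu
    ext l
    obtain ⟨x, hx⟩ := hs (Pi.single l 1)
    have := hB x
    rw [hx] at this
    simpa [Pi.single_apply] using this
  have hni : ¬ Function.Injective B := by
    intro h
    apply hns
    refine (LinearMap.injective_iff_surjective_of_finrank_eq_finrank ?_).1 h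
    rw [Module.finrank_pi_fintype, Module.finrank_fin_fun]
    simp only [hdim]
    exact Finset.sum_coe_sort S ks
  obtain ⟨x, hx, hx0⟩ : ∃ x, B x = 0 ∧ x ≠ 0 := by
    by_contra hh
    push Not at hh
    exact hni ((injective_iff_map_eq_zero B).2 hh)
  let w : (i : Fin t) → Fin (ns i) → L := fun i => if h : i ∈ S then (x ⟨i, h⟩ : Fin (ns i) → L) else 0
  have hw : ∀ i, w i ∈ Cs i := by
    intro i
    by_cases h : i ∈ S
    · simp [w, h]
    · simp [w, h]
  let T := S.filter fun i => w i ≠ 0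
  have hTS : T ⊆ S := Finset.filter_subset _ _
  have hTne : T.Nonempty := by
    obtain ⟨⟨i, hi⟩, hxi⟩ := Function.ne_iff.mp hx0
    refine ⟨i, Finset.mem_filter.2 ⟨hi, ?_⟩⟩
    simpa [w, hi] using hxi
  have hPT := hP T hTne (fun p => w p.1 p.2) hw (fun i hi => (Finset.mem_filter.1 hi).2)
  let inc : {p : (i : Fin t) × Fin (ns i) // p.1 ∈ T} → {p : (i : Fin t) × Fin (ns i) // p.1 ∈ S} :=
    fun p => ⟨p.1, hTS p.2⟩
  have hinc : Function.Injective inc := by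
    intro p q h
    simpa [inc, Subtype.ext_iff] using h
  have hA := rank_lemA (K := K) (M.submatrix id inc)
    (fun p : {p : (i : Fin t) × Fin (ns i) // p.1 ∈ T} => w p.1.1 p.1.2) (by
      intro l
      refine Eq.trans ?_ (congrFun hx l)
      refine Fintype.sum_of_injective inc hinc _ _ ?_ ?_
      · intro p hp
        have hpT : p.1.1 ∉ T := fun h => hp ⟨⟨p.1, h⟩, rfl⟩
        have : w p.1.1 = 0 := by
          by_contra h
          exact hpT (Finset.mem_filter.2 ⟨p.2, h⟩)
        have h3 : (x ⟨p.1.1, p.2⟩ : Fin (ns p.1.1) → L) = 0 := by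
          simpa [w, p.2] using this
        simp [h3]
      · intro p
        have : p.1.1 ∈ S := hTS p.2
        simp [w, this, inc])
  have hBb := rank_lemB (K := K) (M.submatrix id inc)
    (fun p : {p : (i : Fin t) × Fin (ns i) // p.1 ∈ T} => y p.1) u (fun p => hyM (inc p))
  rw [card_blocks] at hA
  by_cases hTe : T = S
  · have hr : (M.submatrix id inc).rank = ∑ i ∈ S, ks i := by
      have hb : Function.Bijective inc := ⟨hinc, fun p => ⟨⟨p.1, by rw [hTe]; exact p.2⟩, rfl⟩⟩
      have := Matrix.rank_submatrix M (Equiv.refl _) (Equiv.ofBijective inc hb)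
      exact this.trans hM
    have : ∑ i ∈ T, ks i = ∑ i ∈ S, ks i := by rw [hTe]
    omega
  · have := ih T (lt_of_le_of_ne hTS hTe) hTne (fun i hi => hy0 i (hTS hi))
    omega

/-- Singleton bound: a code of dimension `n - k` has a nonzero codeword of rank at most `k + 1`. -/
theorem singleton_bound {n k : ℕ} (hk : k < n) (D : Submodule L (Fin n → L))
    (hD : finrank L D = n - k) : ∃ c ∈ D, c ≠ 0 ∧ rankWt K c ≤ k + 1 := by
  classical
  let pr : D →ₗ[L] (Fin (n - k - 1) → L) :=
    (LinearMap.funLeft L L (fun j : Fin (n - k - 1) => (⟨k + 1 + j, by omega⟩ : Fin n))).comp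
      D.subtype
  have : 0 < finrank L (LinearMap.ker pr) := by
    have h1 := LinearMap.finrank_range_add_finrank_ker pr
    have h2 := Submodule.finrank_le (LinearMap.range pr)
    rw [Module.finrank_fin_fun] at h2
    omega
  have hkb : LinearMap.ker pr ≠ ⊥ := by
    intro h
    rw [h, finrank_bot] at this
    exact lt_irrefl _ this
  obtain ⟨⟨c, hcD⟩, hc, hc0⟩ := Submodule.exists_mem_ne_zero_of_ne_bot hkb
  refine ⟨c, hcD, fun h => hc0 (by simpa using h), ?_⟩
  have hz : ∀ j : Fin n, k + 1 ≤ j.1 → c j = 0 := by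
    intro j hj
    have := congrFun (LinearMap.mem_ker.1 hc) ⟨j.1 - (k + 1), by omega⟩
    simp only [pr, LinearMap.comp_apply, LinearMap.funLeft_apply, Submodule.subtype_apply,
      Pi.zero_apply] at this
    rw [← this]
    congr 1
    ext
    simp only
    omega
  have : Submodule.span K (Set.range c) ≤
      Submodule.span K (Set.range fun j : Fin (k + 1) => c ⟨j, by omega⟩) := by
    rw [Submodule.span_le]
    rintro _ ⟨j, rfl⟩
    by_cases h : k + 1 ≤ j.1
    · rw [hz j h]; exact Submodule.zero_mem _
    · exact Submodule.subset_span ⟨⟨j.1, by omega⟩, rfl⟩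
  refine (Submodule.finrank_mono this).trans ?_
  exact (finrank_range_le_card (R := K) (fun j : Fin (k + 1) => c ⟨j, by omega⟩)).trans
    (Fintype.card_fin _).le

theorem nkmrd_dual (hks : ∀ i, 0 < ks i) (hns : ∀ i, ks i < ns i)
    (C : Submodule L (((i : Fin t) × Fin (ns i)) → L)) (ht : 0 < t)
    (h : IsNKMRD K ns ks C) :
    IsNKMRD K ns (fun i => ns i - ks i)
        (LinearMap.BilinForm.orthogonal (dotForm L ((i : Fin t) × Fin (ns i))) C) := by
  classical
  obtain ⟨Cs, hCs, hC, hwt⟩ := h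
  have hmem : ∀ x, x ∈ C ↔ ∀ i, (fun j => x ⟨i, j⟩) ∈ Cs i := by
    intro x
    rw [hC, Submodule.mem_iInf]
    rfl
  have hKN : ∑ i, ks i ≤ ∑ i, ns i := Finset.sum_le_sum fun i _ => (hns i).le
  have hmin : ∀ i, ∃ c ∈ Cs i, c ≠ 0 ∧ rankWt K c + ks i = ns i + 1 := by
    intro i
    have h2 := (hCs i).2
    have hne : {w : ℕ | ∃ c ∈ Cs i, c ≠ 0 ∧ w = rankWt K c}.Nonempty := by
      apply Nat.nonempty_of_pos_sInf
      change 0 < minRankDist K (Cs i)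
      omega
    obtain ⟨c, hc, hc0, hcw⟩ := Nat.sInf_mem hne
    refine ⟨c, hc, hc0, ?_⟩
    change minRankDist K (Cs i) = _ at hcw
    have := hns i
    omega
  have hP := restrict_bound (K := K) (ks := ks) Cs hmin (by
    intro x hx hx0
    have := hwt x ((hmem x).2 hx) hx0
    omega)
  have hQ := dual_bound (K := K) (ks := ks) Cs (fun i => (hCs i).1) (fun i => (hns i).le)
    (fun S => hP _ S rfl)
  let Ds : (i : Fin t) → Submodule L (Fin (ns i) → L) := fun i =>
    LinearMap.BilinForm.orthogonal (dotForm L (Fin (ns i))) (Cs i)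
  have hDs : ∀ i y, y ∈ Ds i ↔ ∀ c ∈ Cs i, ∑ j, c j * y j = 0 := fun i y => Iff.rfl
  have hD : ∀ y, y ∈ LinearMap.BilinForm.orthogonal (dotForm L ((i : Fin t) × Fin (ns i))) C ↔
      ∀ i, (fun j => y ⟨i, j⟩) ∈ Ds i := by
    intro y
    rw [LinearMap.BilinForm.mem_orthogonal_iff]
    constructor
    · intro hy i c hc
      let z : (i : Fin t) → Fin (ns i) → L := Pi.single i c
      have := hy (fun p => z p.1 p.2) ((hmem _).2 (by
        intro i'
        change z i' ∈ _
        by_cases h : i' = i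
        · subst h; simpa [z] using hc
        · simp [z, h]))
      rw [dotForm_apply', Fintype.sum_sigma, Finset.sum_eq_single i] at this
      · rw [dotForm_apply']
        simpa [z] using this
      · intro i' _ h
        simp [z, h]
      · simp
    · intro hy x hx
      rw [dotForm_apply', Fintype.sum_sigma]
      exact Finset.sum_eq_zero fun i _ => hy i _ ((hmem x).1 hx i)
  refine ⟨Ds, ?_, ?_, ?_⟩
  · intro i
    have hdim : finrank L (Ds i) = ns i - ks i := by
      rw [LinearMap.BilinForm.finrank_orthogonal dotForm_nondeg, Module.finrank_fin_fun,
        (hCs i).1]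
    refine ⟨hdim, ?_⟩
    have e : ns i - (ns i - ks i) + 1 = ks i + 1 := by have := hns i; omega
    rw [e]
    have hlow : ∀ c ∈ Ds i, c ≠ 0 → ks i + 1 ≤ rankWt K c := by
      intro c hc hc0
      let z : (i : Fin t) → Fin (ns i) → L := Pi.single i c
      have hzi : z i = c := Pi.single_eq_same ..
      have := hQ (fun p => z p.1 p.2) (by
        intro i' c' hc'
        by_cases h : i' = i
        · subst h
          simp only [hzi]
          exact hc c' hc'
        · simp [z, h]) {i} (Finset.singleton_nonempty i) (by
        intro i' hi'
        rw [Finset.mem_singleton] at hi'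
        subst hi'
        change z i' ≠ 0
        rwa [hzi])
      rw [Finset.sum_singleton] at this
      refine this.trans (Submodule.finrank_mono ?_)
      apply Submodule.span_mono
      rintro _ ⟨⟨⟨i', j⟩, hi'⟩, rfl⟩
      rw [Finset.mem_singleton] at hi'
      dsimp only at hi'
      subst hi'
      exact ⟨j, by rw [← hzi]⟩
    obtain ⟨c, hc, hc0, hcr⟩ := singleton_bound (K := K) (hns i) (Ds i) hdim
    apply le_antisymm
    · exact (Nat.sInf_le ⟨c, hc, hc0, rfl⟩ : minRankDist K (Ds i) ≤ _).trans hcr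
    · refine le_csInf ⟨_, c, hc, hc0, rfl⟩ ?_
      rintro _ ⟨c', hc', hc0', rfl⟩
      exact hlow c' hc' hc0'
  · ext y
    rw [hD, Submodule.mem_iInf]
    rfl
  · intro y hy hy0
    have := hQ y (fun i => (hD y).1 hy i) Finset.univ ⟨⟨0, ht⟩, Finset.mem_univ _⟩
      (fun i _ => hy0 i)
    have e : ∑ i, (ns i - ks i) + ∑ i, ks i = ∑ i, ns i := by
      rw [← Finset.sum_add_distrib]
      exact Finset.sum_congr rfl fun i _ => Nat.sub_add_cancel (hns i).le
    have e2 : rankWt K (fun p : {p : (i : Fin t) × Fin (ns i) // p.1 ∈ Finset.univ} => y p.1)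
        = rankWt K y := by
      exact rankWt_univ _
    rw [e2] at this
    change ∑ i, ns i - ∑ i, (ns i - ks i) + 1 ≤ rankWt K y
    omega

end blocks

/-- Theorem 2.32: `C` is an `(𝐧,𝐤)`-MRD code iff `C^⊥` is an `(𝐧,𝐧−𝐤)`-MRD code. -/
theorem statement18 {K L : Type*} [Field K] [Field L] [Algebra K L]
    [Fintype K] [Fintype L]
    (m : ℕ) (hm : 0 < m) (hmL : Module.finrank K L = m)
    (t : ℕ) (ht : 0 < t) (ks ns : Fin t → ℕ)
    (hks : ∀ i, 0 < ks i) (hns : ∀ i, ks i < ns i) (hnm : ∀ i, ns i ≤ m)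
    (C : Submodule L (((i : Fin t) × Fin (ns i)) → L))
    (hCdim : Module.finrank L ↥C = ∑ i, ks i) :
    IsNKMRD K ns ks C ↔
      IsNKMRD K ns (fun i => ns i - ks i)
        (LinearMap.BilinForm.orthogonal (dotForm L ((i : Fin t) × Fin (ns i))) C) := by
  have hfd : FiniteDimensional K L := Module.finite_of_finrank_pos (by omega)
  constructor
  · exact nkmrd_dual hks hns C ht
  · intro h
    have h2 := nkmrd_dual (ks := fun i => ns i - ks i)
      (fun i => Nat.sub_pos_of_lt (hns i)) (fun i => Nat.sub_lt ((hks i).trans (hns i)) (hks i))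
      _ ht h
    rw [LinearMap.BilinForm.orthogonal_orthogonal
      (B := dotForm L ((i : Fin t) × Fin (ns i))) dotForm_nondeg dotForm_refl] at h2
    have e : (fun i => ns i - (ns i - ks i)) = ks := by
      funext i
      exact Nat.sub_sub_self (hns i).le
    simpa only [e] using h2
end

section
/- Let 𝐤 = (k_1,k_2) and 𝐧 = (n_1,n_2) with k_i < n_i ≤ m for i ∈ {1,2}. Then the weight distribution of an (𝐧,𝐤)-MRD code depends only on 𝐧, 𝐤, q and m; that is, if C and C' are two (𝐧,𝐤)-MRD codes in 𝔽_{q^m}^{n_1+n_2}, then A_i(C) = A_i(C') for every i ∈ {0,1,…,n_1+n_2}, where A_i(·) denotes the number of codewords of rank weight i. -/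
namespace NKMRD
set_option linter.unusedSectionVars false
open Module

section
variable {K L : Type*} [Field K] [Field L] [Algebra K L] {ι : Type*} [Fintype ι]

/-- evaluation of words at a vector over the small field -/
noncomputable def ev (L : Type*) [Field L] [Algebra K L] (a : ι → K) : (ι → L) →ₗ[L] L where
  toFun v := ∑ i, a i • v i
  map_add' x y := by simp [Finset.sum_add_distrib]
  map_smul' c x := by simp [Finset.mul_sum]

/-- the annihilator of a set of vectors over the small field -/
noncomputable def ann (L : Type*) [Field L] [Algebra K L] (U : Submodule K (ι → K)) :
    Submodule L (ι → L) where
  carrier := {v | ∀ a ∈ U, ev L a v = 0}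
  add_mem' := by
    intro x y hx hy a ha
    rw [map_add, hx a ha, hy a ha, add_zero]
  zero_mem' := by intro a _; exact map_zero _
  smul_mem' := by
    intro c x hx a ha
    rw [map_smul, hx a ha, smul_zero]

/-- kernel of a word -/
noncomputable def kr (K : Type*) [Field K] [Algebra K L] (v : ι → L) : Submodule K (ι → K) :=
  LinearMap.ker (Fintype.linearCombination K v)

theorem mem_ann {U : Submodule K (ι → K)} {v : ι → L} :
    v ∈ ann L U ↔ ∀ a ∈ U, ev L a v = 0 := Iff.rfl

theorem le_kr_iff {U : Submodule K (ι → K)} {v : ι → L} : U ≤ kr K v ↔ v ∈ ann L U := by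
  constructor
  · intro h a ha
    simpa [kr, ev, Fintype.linearCombination_apply] using h ha
  · intro h a ha
    simpa [kr, ev, Fintype.linearCombination_apply] using h a ha

theorem rankWt_add (v : ι → L) : rankWt K v + finrank K (kr K v) = Fintype.card ι := by
  have := LinearMap.finrank_range_add_finrank_ker (Fintype.linearCombination K v)
  rw [Fintype.range_linearCombination] at this
  rw [finrank_fintype_fun_eq_card] at this
  exact this

theorem ann_anti {U W : Submodule K (ι → K)} (h : U ≤ W) : ann L W ≤ ann L U :=
  fun _ hx a ha => hx a (h ha)

theorem finrank_le_ker {E : Type*} [AddCommGroup E] [Module L E] [FiniteDimensional L E]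
    (W : Submodule L E) (f : E →ₗ[L] L) :
    finrank L W ≤ finrank L (W ⊓ LinearMap.ker f : Submodule L E) + 1 := by
  have h := LinearMap.finrank_range_add_finrank_ker (f.domRestrict W)
  have h1 : finrank L (LinearMap.range (f.domRestrict W)) ≤ 1 := by
    simpa using Submodule.finrank_le (LinearMap.range (f.domRestrict W))
  have h2 : finrank L (LinearMap.ker (f.domRestrict W)) ≤
      finrank L (W ⊓ LinearMap.ker f : Submodule L E) := by
    rw [(Submodule.equivMapOfInjective W.subtype W.injective_subtype _).finrank_eq]
    apply Submodule.finrank_mono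
    rintro _ ⟨x, hx, rfl⟩
    exact ⟨x.2, hx⟩
  omega

theorem ann_step (C : Submodule L (ι → L)) (U : Submodule K (ι → K)) (a : ι → K) :
    finrank L (C ⊓ ann L U : Submodule L (ι → L)) ≤
      finrank L (C ⊓ ann L (U ⊔ Submodule.span K {a}) : Submodule L (ι → L)) + 1 := by
  refine (finrank_le_ker _ (ev L a)).trans ?_
  gcongr
  apply Submodule.finrank_mono
  rintro x ⟨⟨hC, hU⟩, hx⟩
  refine ⟨hC, le_kr_iff.1 (sup_le (le_kr_iff.2 hU) ?_)⟩
  rw [Submodule.span_singleton_le_iff_mem]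
  simpa [kr, ev, Fintype.linearCombination_apply] using hx

theorem finrank_sup_span {V : Type*} [AddCommGroup V] [Module K V] [FiniteDimensional K V]
    (U : Submodule K V) {a : V} (ha : a ∉ U) :
    finrank K (U ⊔ Submodule.span K {a} : Submodule K V) = finrank K U + 1 := by
  have h := Submodule.finrank_sup_add_finrank_inf_eq U (Submodule.span K {a})
  have h0 : a ≠ 0 := by rintro rfl; exact ha U.zero_mem
  have h1 : U ⊓ Submodule.span K {a} = ⊥ := by
    rw [← disjoint_iff, Submodule.disjoint_span_singleton' h0]
    exact ha
  rw [h1, finrank_bot, finrank_span_singleton h0] at h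
  simpa using h

theorem ann_mono (C : Submodule L (ι → L)) : ∀ (n : ℕ) (U W : Submodule K (ι → K)), U ≤ W →
    finrank K W = finrank K U + n →
    finrank L (C ⊓ ann L U : Submodule L (ι → L)) ≤
      finrank L (C ⊓ ann L W : Submodule L (ι → L)) + n := by
  intro n
  induction n with
  | zero =>
    intro U W hUW h
    rw [Submodule.eq_of_le_of_finrank_eq hUW (by omega)]
    omega
  | succ n ih =>
    intro U W hUW h
    have : ∃ a ∈ W, a ∉ U := by
      by_contra! hc
      have := Submodule.finrank_mono (show W ≤ U from hc)
      omega
    obtain ⟨a, haW, haU⟩ := this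
    have h1 := finrank_sup_span U haU
    have h2 := ih (U ⊔ Submodule.span K {a}) W
      (sup_le hUW (by rwa [Submodule.span_singleton_le_iff_mem])) (by omega)
    have h3 := ann_step C U a
    omega

theorem ann_bot : ann L (⊥ : Submodule K (ι → K)) = ⊤ := by
  rw [eq_top_iff]; intro x _; exact le_kr_iff.1 bot_le

theorem ann_lower (C : Submodule L (ι → L)) (U : Submodule K (ι → K)) :
    finrank L C ≤ finrank L (C ⊓ ann L U : Submodule L (ι → L)) + finrank K U := by
  have := ann_mono C (finrank K U) ⊥ U bot_le (by simp)
  rwa [ann_bot, inf_top_eq] at this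

theorem pk {V : Type*} [AddCommGroup V] [Module K V] (W : Submodule K V) (hW : W ≠ ⊤) :
    ∃ a, a ∉ W := by
  by_contra! hc
  exact hW (by ext; simp [hc])

theorem arith_step {x y k1 k2 u u' a b a' b' n : ℕ} (hn : k1 + k2 - u = n + 1) (s0 : u' = u + 1)
    (s : x ≤ y + 1) (s' : y ≤ max (k1 + k2 - u') (max a' b')) (c1 : a' ≤ a - 1) (c2 : b' ≤ b - 1) :
    x ≤ max (k1 + k2 - u) (max a b) := by
  omega

theorem exists_ext {V : Type*} [AddCommGroup V] [Module K V] [FiniteDimensional K V] :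
    ∀ (n : ℕ) (U : Submodule K V), finrank K U + n ≤ finrank K V →
    ∃ W, U ≤ W ∧ finrank K W = finrank K U + n := by
  intro n
  induction n with
  | zero => intro U _; exact ⟨U, le_rfl, rfl⟩
  | succ n ih =>
    intro U h
    obtain ⟨W, hW, hd⟩ := ih U (by omega)
    have : ∃ a, a ∉ W := by
      by_contra! hc
      have : W = ⊤ := by ext; simp [hc]
      rw [this, finrank_top] at hd
      omega
    obtain ⟨a, ha⟩ := this
    exact ⟨_, hW.trans le_sup_left, by rw [finrank_sup_span W ha]; omega⟩

theorem mrd_upper (C : Submodule L (ι → L)) (k : ℕ) (hk : k ≤ Fintype.card ι)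
    (hd : ∀ c ∈ C, c ≠ 0 → Fintype.card ι - k + 1 ≤ rankWt K c) (U : Submodule K (ι → K)) :
    finrank L (C ⊓ ann L U : Submodule L (ι → L)) ≤ k - finrank K U := by
  have big : ∀ W : Submodule K (ι → K), k ≤ finrank K W →
      finrank L (C ⊓ ann L W : Submodule L (ι → L)) = 0 := by
    intro W hW
    rw [Submodule.finrank_eq_zero, Submodule.eq_bot_iff]
    rintro x ⟨hx, hxW⟩
    by_contra h0
    have h1 := hd x hx h0
    have h2 := Submodule.finrank_mono (le_kr_iff.2 hxW)
    have h3 := rankWt_add (K := K) x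
    omega
  rcases le_total k (finrank K U) with h | h
  · rw [big U h]; omega
  · obtain ⟨W, hW, hd⟩ := exists_ext (k - finrank K U) U (by simp; omega)
    have := ann_mono C _ U W hW hd
    rw [big W (by omega)] at this
    omega
end

section
variable {K L : Type*} [Field K] [Field L] [Algebra K L] {ι α β : Type*} [Fintype ι]
  [Fintype α] [Fintype β]

theorem ev_split (i1 : α → ι) (i2 : β → ι) (hb : Function.Bijective (Sum.elim i1 i2))
    (a : ι → K) (x : ι → L) : ev L a x = ev L (a ∘ i1) (x ∘ i1) + ev L (a ∘ i2) (x ∘ i2) := by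
  simp only [ev, LinearMap.coe_mk, AddHom.coe_mk]
  rw [← Function.Bijective.sum_comp hb, Fintype.sum_sum_type]
  rfl

theorem exists_glue {X : Type*} (i1 : α → ι) (i2 : β → ι)
    (hb : Function.Bijective (Sum.elim i1 i2)) (a : α → X) (b : β → X) :
    ∃ c : ι → X, c ∘ i1 = a ∧ c ∘ i2 = b := by
  let e := Equiv.ofBijective _ hb
  refine ⟨Sum.elim a b ∘ e.symm, ?_, ?_⟩
  · ext j
    have : e.symm (i1 j) = Sum.inl j := by rw [Equiv.symm_apply_eq]; rfl
    simp [this]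
  · ext j
    have : e.symm (i2 j) = Sum.inr j := by rw [Equiv.symm_apply_eq]; rfl
    simp [this]

theorem ext_glue {X : Type*} (i1 : α → ι) (i2 : β → ι)
    (hb : Function.Bijective (Sum.elim i1 i2)) {x y : ι → X} (h1 : x ∘ i1 = y ∘ i1)
    (h2 : x ∘ i2 = y ∘ i2) : x = y := by
  ext j
  obtain ⟨s, rfl⟩ := hb.2 j
  rcases s with s | s
  · exact congrFun h1 s
  · exact congrFun h2 s

/-- splitting equivalence -/
noncomputable def spl (F : Type*) [Field F] (i1 : α → ι) (i2 : β → ι)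
    (hb : Function.Bijective (Sum.elim i1 i2)) : (ι → F) ≃ₗ[F] (α → F) × (β → F) :=
  LinearEquiv.ofBijective ((LinearMap.funLeft F F i1).prod (LinearMap.funLeft F F i2)) <| by
    constructor
    · intro x y h
      exact ext_glue i1 i2 hb (congrArg Prod.fst h) (congrArg Prod.snd h)
    · rintro ⟨a, b⟩
      obtain ⟨c, h1, h2⟩ := exists_glue i1 i2 hb a b
      exact ⟨c, Prod.ext h1 h2⟩

/-- two-block hypothesis bundle is passed explicitly -/
theorem sum_bij_swap (i1 : α → ι) (i2 : β → ι) (hb : Function.Bijective (Sum.elim i1 i2)) :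
    Function.Bijective (Sum.elim i2 i1) := by
  have : Sum.elim i2 i1 = Sum.elim i1 i2 ∘ Sum.swap := by
    ext s; rcases s with s | s <;> rfl
  rw [this]
  exact hb.comp (Equiv.sumComm β α).bijective

theorem code_finrank (i1 : α → ι) (i2 : β → ι) (hb : Function.Bijective (Sum.elim i1 i2))
    (C : Submodule L (ι → L)) (C1 : Submodule L (α → L)) (C2 : Submodule L (β → L))
    (hC : ∀ x, x ∈ C ↔ x ∘ i1 ∈ C1 ∧ x ∘ i2 ∈ C2) :
    finrank L C = finrank L C1 + finrank L C2 := by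
  have h : C = (C1.prod C2).comap (spl L i1 i2 hb).toLinearMap := by
    ext x; rw [hC]; rfl
  have h2 : finrank L C = finrank L (C1.prod C2) := by
    rw [h]
    exact LinearEquiv.finrank_eq ((spl L i1 i2 hb).ofSubmodule' (C1.prod C2))
  let e : (C1.prod C2) ≃ₗ[L] C1 × C2 :=
    { toFun := fun x => (⟨x.1.1, x.2.1⟩, ⟨x.1.2, x.2.2⟩)
      invFun := fun y => ⟨(y.1.1, y.2.1), ⟨y.1.2, y.2.2⟩⟩
      map_add' := fun _ _ => rfl
      map_smul' := fun _ _ => rfl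
      left_inv := fun _ => rfl
      right_inv := fun _ => rfl }
  rw [h2, e.finrank_eq, finrank_prod]

/-- words of the first block, annihilated by the projection of `U` -/
theorem block_lower (i1 : α → ι) (i2 : β → ι) (hb : Function.Bijective (Sum.elim i1 i2))
    (C : Submodule L (ι → L)) (C1 : Submodule L (α → L)) (C2 : Submodule L (β → L))
    (hC : ∀ x, x ∈ C ↔ x ∘ i1 ∈ C1 ∧ x ∘ i2 ∈ C2) (U : Submodule K (ι → K)) :
    finrank L (C1 ⊓ ann L (U.map (LinearMap.funLeft K K i1)) : Submodule L (α → L)) ≤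
      finrank L (C ⊓ ann L U : Submodule L (ι → L)) := by
  let E : (α → L) →ₗ[L] (ι → L) := (spl L i1 i2 hb).symm.toLinearMap ∘ₗ LinearMap.inl L _ _
  have hE : ∀ x, E x ∘ i1 = x ∧ E x ∘ i2 = 0 := by
    intro x
    have : spl L i1 i2 hb (E x) = (x, 0) := by simp [E]
    exact ⟨congrArg Prod.fst this, congrArg Prod.snd this⟩
  have hinj : Function.Injective E := by
    intro x y h
    rw [← (hE x).1, h, (hE y).1]
  rw [(Submodule.equivMapOfInjective E hinj _).finrank_eq]
  apply Submodule.finrank_mono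
  rintro _ ⟨x, ⟨hx, hxU⟩, rfl⟩
  refine ⟨(hC _).2 ?_, ?_⟩
  · rw [(hE x).1, (hE x).2]
    exact ⟨hx, C2.zero_mem⟩
  · intro a ha
    rw [ev_split i1 i2 hb, (hE x).1, (hE x).2, map_zero, add_zero]
    exact hxU _ ⟨a, ha, rfl⟩

theorem block_upper (i1 : α → ι) (i2 : β → ι) (hb : Function.Bijective (Sum.elim i1 i2))
    (C : Submodule L (ι → L)) (C1 : Submodule L (α → L)) (C2 : Submodule L (β → L))
    (hC : ∀ x, x ∈ C ↔ x ∘ i1 ∈ C1 ∧ x ∘ i2 ∈ C2) (U : Submodule K (ι → K))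
    (h : ∀ x ∈ C ⊓ ann L U, x ∘ i2 = 0) :
    finrank L (C ⊓ ann L U : Submodule L (ι → L)) ≤ 
    finrank L (C1 ⊓ ann L (U.map (LinearMap.funLeft K K i1)) : Submodule L (α → L)) := by
  let f : (C ⊓ ann L U : Submodule L (ι → L)) →ₗ[L]
      (C1 ⊓ ann L (U.map (LinearMap.funLeft K K i1)) : Submodule L (α → L)) :=
    (LinearMap.funLeft L L i1).restrict <| by
      intro x hx
      refine ⟨((hC x).1 hx.1).1, ?_⟩
      rintro _ ⟨a, ha, rfl⟩
      have := hx.2 a ha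
      rw [ev_split i1 i2 hb, h x hx, map_zero, add_zero] at this
      exact this
  apply LinearMap.finrank_le_finrank_of_injective (f := f)
  intro x y hxy
  apply Subtype.ext
  refine ext_glue i1 i2 hb (congrArg Subtype.val hxy) ?_
  rw [h _ x.2, h _ y.2]

/-- dimension formula -/
theorem dim_formula (i1 : α → ι) (i2 : β → ι) (hb : Function.Bijective (Sum.elim i1 i2))
    (C : Submodule L (ι → L)) (C1 : Submodule L (α → L)) (C2 : Submodule L (β → L))
    (hC : ∀ x, x ∈ C ↔ x ∘ i1 ∈ C1 ∧ x ∘ i2 ∈ C2) (k1 k2 : ℕ)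
    (hk1 : k1 < Fintype.card α) (hk2 : k2 < Fintype.card β)
    (hf1 : finrank L C1 = k1) (hf2 : finrank L C2 = k2)
    (hd1 : ∀ c ∈ C1, c ≠ 0 → Fintype.card α - k1 + 1 ≤ rankWt K c)
    (hd2 : ∀ c ∈ C2, c ≠ 0 → Fintype.card β - k2 + 1 ≤ rankWt K c)
    (hd : ∀ x ∈ C, x ∘ i1 ≠ 0 → x ∘ i2 ≠ 0 → Fintype.card ι - (k1 + k2) + 1 ≤ rankWt K x)
    (U : Submodule K (ι → K)) :
    finrank L (C ⊓ ann L U : Submodule L (ι → L)) =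
      max (k1 + k2 - finrank K U) (max (k1 - finrank K (U.map (LinearMap.funLeft K K i1)))
        (k2 - finrank K (U.map (LinearMap.funLeft K K i2)))) := by
  have hb' := sum_bij_swap i1 i2 hb
  have hC' : ∀ x, x ∈ C ↔ x ∘ i2 ∈ C2 ∧ x ∘ i1 ∈ C1 := fun x => by rw [hC, and_comm]
  have hcard : Fintype.card ι = Fintype.card α + Fintype.card β := by
    rw [← Fintype.card_sum]; exact (Fintype.card_of_bijective hb).symm
  apply le_antisymm
  · obtain ⟨n, hn⟩ : ∃ n, k1 + k2 - finrank K U = n := ⟨_, rfl⟩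
    induction n generalizing U with
    | zero =>
      have key : ∀ x ∈ C ⊓ ann L U, x ∘ i1 = 0 ∨ x ∘ i2 = 0 := by
        intro x hx
        by_contra! hc
        have h1 := hd x hx.1 hc.1 hc.2
        have h2 := Submodule.finrank_mono (le_kr_iff.2 hx.2)
        have h3 := rankWt_add (K := K) x
        omega
      by_cases h2 : ∀ x ∈ C ⊓ ann L U, x ∘ i2 = 0
      · have a1 := block_upper i1 i2 hb C C1 C2 hC U h2
        have a2 := mrd_upper C1 k1 hk1.le hd1 (U.map (LinearMap.funLeft K K i1))
        omega
      · have h1 : ∀ x ∈ C ⊓ ann L U, x ∘ i1 = 0 := by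
          push Not at h2
          obtain ⟨y, hy, hy2⟩ := h2
          have hy1 := (key y hy).resolve_right hy2
          intro x hx
          by_contra hx1
          have hx2 := (key x hx).resolve_left hx1
          rcases key (x + y) (Submodule.add_mem _ hx hy) with h | h
          · apply hx1
            have : (x + y) ∘ i1 = x ∘ i1 + y ∘ i1 := rfl
            rw [this, hy1, add_zero] at h
            exact h
          · apply hy2
            have : (x + y) ∘ i2 = x ∘ i2 + y ∘ i2 := rfl
            rw [this, hx2, zero_add] at h
            exact h
        have a1 := block_upper i2 i1 hb' C C2 C1 hC' U h1
        have a2 := mrd_upper C2 k2 hk2.le hd2 (U.map (LinearMap.funLeft K K i2))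
        omega
    | succ n ih =>
      set p1 := LinearMap.funLeft K K i1 with hp1
      set p2 := LinearMap.funLeft K K i2 with hp2
      -- choice of the new vector
      have pick : ∃ a, a ∉ U ∧ (U.map p1 = ⊤ ∨ p1 a ∉ U.map p1) ∧
          (U.map p2 = ⊤ ∨ p2 a ∉ U.map p2) := by
        by_cases t1 : U.map p1 = ⊤
        · by_cases t2 : U.map p2 = ⊤
          · have : U ≠ ⊤ := by
              rintro rfl
              rw [finrank_top, finrank_fintype_fun_eq_card] at hn
              omega
            obtain ⟨a, ha⟩ := pk U this
            exact ⟨a, ha, Or.inl t1, Or.inl t2⟩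
          · obtain ⟨b, hb2⟩ := pk _ t2
            obtain ⟨a, ha1, ha2⟩ := exists_glue i1 i2 hb (0 : α → K) b
            have e2 : p2 a = b := ha2
            refine ⟨a, fun h => hb2 ⟨a, h, e2⟩, Or.inl t1, Or.inr (by rwa [e2])⟩
        · obtain ⟨b, hb1⟩ := pk _ t1
          have : ∃ c, U.map p2 = ⊤ ∨ c ∉ U.map p2 := by
            by_cases t2 : U.map p2 = ⊤
            · exact ⟨0, Or.inl t2⟩
            · obtain ⟨c, hc⟩ := pk _ t2
              exact ⟨c, Or.inr hc⟩
          obtain ⟨c, hc⟩ := this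
          obtain ⟨a, ha1, ha2⟩ := exists_glue i1 i2 hb b c
          have e1 : p1 a = b := ha1
          have e2 : p2 a = c := ha2
          exact ⟨a, fun h => hb1 ⟨a, h, e1⟩, Or.inr (by rwa [e1]), by rwa [e2]⟩
      obtain ⟨a, haU, ha1, ha2⟩ := pick
      have s0 := finrank_sup_span U haU
      have s := ann_step C U a
      have s' := ih (U ⊔ Submodule.span K {a}) (by omega)
      have m1 : (U ⊔ Submodule.span K {a}).map p1 = U.map p1 ⊔ Submodule.span K {p1 a} := by
        rw [Submodule.map_sup, Submodule.map_span, Set.image_singleton]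
      have m2 : (U ⊔ Submodule.span K {a}).map p2 = U.map p2 ⊔ Submodule.span K {p2 a} := by
        rw [Submodule.map_sup, Submodule.map_span, Set.image_singleton]
      rw [m1, m2] at s'
      have c1 : k1 - finrank K (U.map p1 ⊔ Submodule.span K {p1 a} : Submodule K (α → K)) ≤
          k1 - finrank K (U.map p1) - 1 := by
        rcases ha1 with h | h
        · rw [h, top_sup_eq, finrank_top, finrank_fintype_fun_eq_card]; omega
        · rw [finrank_sup_span _ h]; omega
      have c2 : k2 - finrank K (U.map p2 ⊔ Submodule.span K {p2 a} : Submodule K (β → K)) ≤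
          k2 - finrank K (U.map p2) - 1 := by
        rcases ha2 with h | h
        · rw [h, top_sup_eq, finrank_top, finrank_fintype_fun_eq_card]; omega
        · rw [finrank_sup_span _ h]; omega
      exact arith_step hn s0 s s' c1 c2
  · have l0 := ann_lower C U
    rw [code_finrank i1 i2 hb C C1 C2 hC] at l0
    have l1 := block_lower i1 i2 hb C C1 C2 hC U
    have l2 := block_lower i2 i1 hb' C C2 C1 hC' U
    have l1' := ann_lower C1 (U.map (LinearMap.funLeft K K i1))
    have l2' := ann_lower C2 (U.map (LinearMap.funLeft K K i2))
    omega
end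

section
open Finset
open scoped Classical in
theorem fiber_eq {X P : Type*} [PartialOrder P] [Fintype P] (S T : Finset X) (key : X → P)
    (h : ∀ U, #{x ∈ S | U ≤ key x} = #{x ∈ T | U ≤ key x}) :
    ∀ U, #{x ∈ S | key x = U} = #{x ∈ T | key x = U} := by
  have split : ∀ (S : Finset X) (U : P), #{x ∈ S | U ≤ key x} =
      #{x ∈ S | key x = U} + ∑ W with U < W, #{x ∈ S | key x = W} := by
    intro S U
    have h1 : ({x ∈ S | U ≤ key x} : Finset X) =
        {x ∈ S | key x = U} ∪ {x ∈ S | U < key x} := by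
      ext x
      simp only [mem_filter, mem_union, le_iff_eq_or_lt, eq_comm (a := U)]
      tauto
    rw [h1, card_union_of_disjoint]
    · congr 1
      rw [card_eq_sum_card_fiberwise (f := key) (t := ({W | U < W} : Finset P))]
      · apply sum_congr rfl
        intro W hW
        congr 1
        ext x
        simp only [mem_filter, mem_univ, true_and] at hW ⊢
        constructor
        · rintro ⟨⟨a, b⟩, c⟩; exact ⟨a, c⟩
        · rintro ⟨a, c⟩; exact ⟨⟨a, c ▸ hW⟩, c⟩
      · intro x hx
        simp at hx ⊢
        exact hx.2
    · rw [disjoint_filter]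
      intro x _ h1 h2
      exact absurd h1 h2.ne'
  intro U
  induction U using (wellFounded_gt (α := P)).induction with
  | _ U ih =>
    have := h U
    rw [split, split, sum_congr rfl (fun W hW => ih W (by simpa using hW))] at this
    omega

open scoped Classical in
theorem fiber_eq' {X P : Type*} [PartialOrder P] [Fintype P] (S T : Finset X) (key : X → P)
    (h : ∀ U, #{x ∈ S | U ≤ key x} = #{x ∈ T | U ≤ key x}) (f : P → ℕ) (i : ℕ) :
    #{x ∈ S | f (key x) = i} = #{x ∈ T | f (key x) = i} := by
  have split : ∀ (S : Finset X), #{x ∈ S | f (key x) = i} =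
      ∑ W with f W = i, #{x ∈ S | key x = W} := by
    intro S
    rw [card_eq_sum_card_fiberwise (f := key) (t := ({W | f W = i} : Finset P))]
    · apply sum_congr rfl
      intro W hW
      congr 1
      ext x
      simp only [mem_filter, mem_univ, true_and] at hW ⊢
      constructor
      · rintro ⟨⟨a, b⟩, c⟩; exact ⟨a, c⟩
      · rintro ⟨a, c⟩; exact ⟨⟨a, c ▸ hW⟩, c⟩
    · intro x hx
      simp at hx ⊢
      exact hx.2
  rw [split, split]
  exact sum_congr rfl fun W _ => fiber_eq S T key h W

open scoped Classical in
theorem count_eq {K L : Type*} [Field K] [Field L] [Algebra K L] [Fintype K] [Fintype L]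
    {ι : Type*} [Fintype ι] (C D : Submodule L (ι → L))
    (h : ∀ U : Submodule K (ι → K), finrank L (C ⊓ ann L U : Submodule L (ι → L)) =
      finrank L (D ⊓ ann L U : Submodule L (ι → L))) (i : ℕ) :
    Nat.card {c : C // rankWt K (c : ι → L) = i} =
      Nat.card {c : D // rankWt K (c : ι → L) = i} := by
  have conv : ∀ E : Submodule L (ι → L), Nat.card {c : E // rankWt K (c : ι → L) = i} =
      #{x ∈ ({x | x ∈ E} : Finset (ι → L)) | Fintype.card ι - finrank K (kr K x) = i} := by
    intro E
    rw [Nat.card_congr (Equiv.subtypeSubtypeEquivSubtypeInter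
      (fun x => x ∈ E) (fun x => rankWt K x = i)), Nat.card_eq_fintype_card, Fintype.card_subtype]
    congr 1
    ext x
    have := rankWt_add (K := K) x
    have h2 : Fintype.card ι - finrank K (kr K x) = rankWt K x := by omega
    simp [h2]
  have : Fintype (Submodule K (ι → K)) := Fintype.ofFinite _
  rw [conv, conv]
  apply fiber_eq' _ _ (kr K) _ (fun U => Fintype.card ι - finrank K U)
  intro U
  have cnt : ∀ E : Submodule L (ι → L), #{x ∈ ({x | x ∈ E} : Finset (ι → L)) | U ≤ kr K x} =
      Fintype.card L ^ finrank L (E ⊓ ann L U : Submodule L (ι → L)) := by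
    intro E
    rw [← Module.card_eq_pow_finrank, Fintype.card_subtype]
    congr 1
    ext x
    simp [le_kr_iff]
  rw [cnt, cnt, h]
end
end NKMRD

/-- Theorem 2.33: for `t = 2`, the weight distribution of an `(𝐧,𝐤)`-MRD code
depends only on `𝐧`, `𝐤`, `q` and `m`. -/
theorem statement19 {K L : Type*} [Field K] [Field L] [Algebra K L]
    [Fintype K] [Fintype L]
    (m : ℕ) (hm : 0 < m) (hmL : Module.finrank K L = m)
    (n1 n2 k1 k2 : ℕ) (h1 : k1 < n1) (h2 : k2 < n2)
    (hn1 : n1 ≤ m) (hn2 : n2 ≤ m) (hk1 : 0 < k1) (hk2 : 0 < k2)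
    (C C' : Submodule L (((i : Fin 2) × Fin (![n1, n2] i)) → L))
    (hC : IsNKMRD K ![n1, n2] ![k1, k2] C)
    (hC' : IsNKMRD K ![n1, n2] ![k1, k2] C') :
    ∀ i : ℕ, i ≤ n1 + n2 →
      Nat.card {c : ↥C // rankWt K (c : ((i : Fin 2) × Fin (![n1, n2] i)) → L) = i} =
        Nat.card {c : ↥C' // rankWt K (c : ((i : Fin 2) × Fin (![n1, n2] i)) → L) = i} := by
  have hb : Function.Bijective (Sum.elim (fun j : Fin n1 => (⟨0, j⟩ : (i : Fin 2) × Fin (![n1, n2] i)))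
      (fun j : Fin n2 => (⟨1, j⟩ : (i : Fin 2) × Fin (![n1, n2] i)))) := by
    constructor
    · rintro (a | a) (b | b) h
      · exact congrArg Sum.inl (eq_of_heq (Sigma.mk.inj h).2)
      · exact absurd (Sigma.mk.inj h).1 (by decide)
      · exact absurd (Sigma.mk.inj h).1 (by decide)
      · exact congrArg Sum.inr (eq_of_heq (Sigma.mk.inj h).2)
    · rintro ⟨i, j⟩
      fin_cases i
      · exact ⟨Sum.inl j, rfl⟩
      · exact ⟨Sum.inr j, rfl⟩
  have hcard : Fintype.card ((i : Fin 2) × Fin (![n1, n2] i)) = n1 + n2 := by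
    simp
  have key : ∀ D : Submodule L (((i : Fin 2) × Fin (![n1, n2] i)) → L),
      IsNKMRD K ![n1, n2] ![k1, k2] D →
      ∀ U : Submodule K (((i : Fin 2) × Fin (![n1, n2] i)) → K),
      Module.finrank L (D ⊓ NKMRD.ann L U :
        Submodule L (((i : Fin 2) × Fin (![n1, n2] i)) → L)) =
      max (k1 + k2 - Module.finrank K U) (max
        (k1 - Module.finrank K (U.map (LinearMap.funLeft K K
          (fun j : Fin n1 => (⟨0, j⟩ : (i : Fin 2) × Fin (![n1, n2] i))))))
        (k2 - Module.finrank K (U.map (LinearMap.funLeft K K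
          (fun j : Fin n2 => (⟨1, j⟩ : (i : Fin 2) × Fin (![n1, n2] i))))))) := by
    intro D hD U
    obtain ⟨Cs, hM, hE, hd⟩ := hD
    have dist : ∀ i, ∀ c ∈ Cs i, c ≠ 0 → ![n1, n2] i - ![k1, k2] i + 1 ≤ rankWt K c := by
      intro i c hc h0
      rw [← (hM i).2]
      exact Nat.sInf_le ⟨c, hc, h0, rfl⟩
    refine NKMRD.dim_formula (K := K) _ _ hb D (Cs 0) (Cs 1) ?_ k1 k2 (by simpa using h1)
      (by simpa using h2) (hM 0).1 (hM 1).1 ?_ ?_ ?_ U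
    · intro x
      rw [hE]
      simp only [Submodule.mem_iInf, Submodule.mem_comap, Fin.forall_fin_two]
      rfl
    · rw [Fintype.card_fin]; exact dist 0
    · rw [Fintype.card_fin]; exact dist 1
    · intro x hx a b
      rw [hcard]
      have := hd x hx (Fin.forall_fin_two.2 ⟨a, b⟩)
      simpa [Fin.sum_univ_two] using this
  intro i _
  exact NKMRD.count_eq C C' (fun U => (key C hC U).trans (key C' hC' U).symm) i
end
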